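/- arXiv:2304.14172 — 2 statements merged into one kernel-verified Lean document; each statement's English description precedes it below -/
import Mathlib

section
/- For every integer k ≥ 1, if G is a finite k-tough graph such that k·|V(G)| is even and |V(G)| ≥ k+1, then G has a k-factor, i.e., a spanning subgraph F of G with d_F(v) = k for every vertex v of G. -/
noncomputable section

namespace SimpleGraph

/-- `𝒞` is a family of pairwise disjoint sets of odd size, each of them a union of connected
components of `H - X`. -/
structure IsOddFamily {W : Type*} [DecidableEq W] (H : SimpleGraph W) (X : Finset W)
    (𝒞 : Finset (Finset W)) : Prop where
  eq_of_mem : ∀ C ∈ 𝒞, ∀ D ∈ 𝒞, ∀ a, a ∈ C → a ∈ D → C = D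
  notMem : ∀ C ∈ 𝒞, ∀ a ∈ C, a ∉ X
  closed : ∀ C ∈ 𝒞, ∀ a ∈ C, ∀ b ∉ X, H.Adj a b → b ∈ C
  odd : ∀ C ∈ 𝒞, Odd C.card

theorem IsOddFamily.erase {W : Type*} [DecidableEq W] {H : SimpleGraph W} [DecidableRel H.Adj]
    {X : Finset W} {𝒞 : Finset (Finset W)}
    (h : H.IsOddFamily X 𝒞) (x : W) :
    H.IsOddFamily (X.erase x) (𝒞.filter fun C => ¬ ∃ c ∈ C, H.Adj x c) where
  eq_of_mem C hC D hD := h.eq_of_mem C (Finset.mem_filter.1 hC).1 D (Finset.mem_filter.1 hD).1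
  notMem C hC a ha hmem := h.notMem C (Finset.mem_filter.1 hC).1 a ha (Finset.mem_of_mem_erase hmem)
  closed C hC a ha b hb hab := by
    obtain ⟨hC, hx⟩ := Finset.mem_filter.1 hC
    refine h.closed C hC a ha b (fun hbX => hb (Finset.mem_erase.2 ⟨?_, hbX⟩)) hab
    rintro rfl
    exact hx ⟨a, ha, hab.symm⟩
  odd C hC := h.odd C (Finset.mem_filter.1 hC).1

theorem IsOddFamily.card_filter_le {W : Type*} [DecidableEq W] {H : SimpleGraph W} {X : Finset W}
    {𝒞 : Finset (Finset W)} (h : H.IsOddFamily X 𝒞) (Z : Finset W) :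
    (𝒞.filter fun C => ∃ z ∈ Z, z ∈ C).card ≤ Z.card := by
  refine Finset.card_le_card_of_forall_subsingleton (fun C z => z ∈ C)
    (fun C hC => (Finset.mem_filter.1 hC).2) fun z _ C hC D hD => ?_
  exact h.eq_of_mem C (Finset.mem_filter.1 hC.1).1 D (Finset.mem_filter.1 hD.1).1 z hC.2 hD.2

section OddFamily

variable {W : Type*} [Fintype W] [DecidableEq W] {H : SimpleGraph W}

theorem IsTutteViolator.exists_isOddFamily {X : Set W} (h : H.IsTutteViolator X) :
    ∃ (X : Finset W) (𝒞 : Finset (Finset W)), H.IsOddFamily X 𝒞 ∧ X.card < 𝒞.card := by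
  classical
  set H' := ((⊤ : H.Subgraph).deleteVerts X).coe with hH'
  let f : H'.ConnectedComponent → Finset W := fun c => (Subtype.val '' c.supp).toFinset
  have hf : ∀ c w, w ∈ f c ↔ ∃ hw : w ∈ ((⊤ : H.Subgraph).deleteVerts X).verts,
      H'.connectedComponentMk ⟨w, hw⟩ = c := by
    intro c w
    simp [f]
  have hne : ∀ c, ∃ w, w ∈ f c := by
    intro c
    obtain ⟨w, rfl⟩ := c.exists_rep
    exact ⟨w.1, (hf _ _).2 ⟨w.2, rfl⟩⟩
  have hinj : ∀ c d w, w ∈ f c → w ∈ f d → c = d := by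
    intro c d w hc hd
    obtain ⟨h1, rfl⟩ := (hf _ _).1 hc
    obtain ⟨h2, rfl⟩ := (hf _ _).1 hd
    rfl
  refine ⟨X.toFinset, H'.oddComponents.toFinset.image f, ⟨?_, ?_, ?_, ?_⟩, ?_⟩
  · simp only [Finset.mem_image]
    rintro _ ⟨c, -, rfl⟩ _ ⟨d, -, rfl⟩ a ha hb
    rw [hinj c d a ha hb]
  · simp only [Finset.mem_image]
    rintro _ ⟨c, -, rfl⟩ a ha
    obtain ⟨h1, -⟩ := (hf _ _).1 ha
    simpa using h1
  · simp only [Finset.mem_image]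
    rintro _ ⟨c, -, rfl⟩ a ha b hb hab
    obtain ⟨h1, rfl⟩ := (hf _ _).1 ha
    have h2 : b ∈ ((⊤ : H.Subgraph).deleteVerts X).verts := by simpa using hb
    refine (hf _ _).2 ⟨h2, ?_⟩
    rw [ConnectedComponent.eq]
    refine Adj.reachable ?_
    simp only [Subgraph.deleteVerts_verts, Subgraph.verts_top, Set.mem_sdiff, Set.mem_univ,
      true_and] at h1 h2
    simp [hH', h1, h2, hab.symm]
  · simp only [Finset.mem_image]
    rintro _ ⟨c, hc, rfl⟩
    have hc : Odd c.supp.ncard := by simpa using! hc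
    rwa [← Set.ncard_eq_toFinset_card', Set.ncard_image_of_injective _ Subtype.val_injective]
  · rw [Finset.card_image_of_injective, ← Set.ncard_eq_toFinset_card',
      ← Set.ncard_eq_toFinset_card']
    · exact h
    · intro c d hcd
      obtain ⟨w, hw⟩ := hne c
      exact hinj c d w hw (hcd ▸ hw)

/-- An odd family with more members than `X` can be completed by parity. -/
theorem IsOddFamily.exists_add_two_le {X : Finset W} {𝒞 : Finset (Finset W)}
    (h : H.IsOddFamily X 𝒞) (hW : Even (Fintype.card W)) (hlt : X.card < 𝒞.card) :
    ∃ 𝒞, H.IsOddFamily X 𝒞 ∧ X.card + 2 ≤ 𝒞.card := by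
  by_cases h2 : X.card + 2 ≤ 𝒞.card
  · exact ⟨𝒞, h, h2⟩
  have hcard : 𝒞.card = X.card + 1 := by lia
  let R : Finset W := (X ∪ 𝒞.biUnion id)ᶜ
  have hR : ∀ a, a ∈ R ↔ a ∉ X ∧ ∀ C ∈ 𝒞, a ∉ C := by simp [R]
  have hbi : (𝒞.biUnion id).card = ∑ C ∈ 𝒞, C.card := by
    refine Finset.card_biUnion fun C hC D hD hne => ?_
    rw [Function.onFun, Finset.disjoint_left]
    exact fun a ha hb => hne (h.eq_of_mem C hC D hD a ha hb)
  have hmod : (∑ C ∈ 𝒞, C.card) % 2 = 𝒞.card % 2 := by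
    rw [Finset.sum_nat_mod, Finset.sum_congr rfl fun C hC => Nat.odd_iff.1 (h.odd C hC)]
    simp
  have hdisj : Disjoint X (𝒞.biUnion id) := by
    rw [Finset.disjoint_right]
    intro a ha
    obtain ⟨C, hC, haC⟩ := Finset.mem_biUnion.1 ha
    exact h.notMem C hC a haC
  have htot : X.card + ∑ C ∈ 𝒞, C.card + R.card = Fintype.card W := by
    rw [← hbi, ← Finset.card_union_of_disjoint hdisj, Finset.card_add_card_compl]
  have hRodd : Odd R.card := by
    rw [Nat.even_iff] at hW
    rw [Nat.odd_iff]
    lia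
  have hRnot : R ∉ 𝒞 := by
    intro hmem
    obtain ⟨a, ha⟩ := Finset.card_pos.1 hRodd.pos
    exact ((hR a).1 ha).2 R hmem ha
  refine ⟨insert R 𝒞, ⟨?_, ?_, ?_, ?_⟩, ?_⟩
  · intro C hC D hD a ha hb
    rw [Finset.mem_insert] at hC hD
    rcases hC with rfl | hC <;> rcases hD with rfl | hD
    · rfl
    · exact absurd hb (((hR a).1 ha).2 D hD)
    · exact absurd ha (((hR a).1 hb).2 C hC)
    · exact h.eq_of_mem C hC D hD a ha hb
  · intro C hC a ha
    rcases Finset.mem_insert.1 hC with rfl | hC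
    · exact ((hR a).1 ha).1
    · exact h.notMem C hC a ha
  · intro C hC a ha b hb hab
    rcases Finset.mem_insert.1 hC with rfl | hC
    · refine (hR b).2 ⟨hb, fun D hD hbD => ?_⟩
      exact ((hR a).1 ha).2 D hD (h.closed D hD b hbD a ((hR a).1 ha).1 hab.symm)
    · exact h.closed C hC a ha b hb hab
  · intro C hC
    rcases Finset.mem_insert.1 hC with rfl | hC
    · exact hRodd
    · exact h.odd C hC
  · rw [Finset.card_insert_of_notMem hRnot]
    lia

/-- A graph of even order without a perfect matching has a Tutte violator each of whose vertices
is adjacent to at least three odd components. -/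
theorem exists_isOddFamily_three_le [DecidableRel H.Adj]
    (hno : ∀ M : H.Subgraph, ¬ M.IsPerfectMatching) (hW : Even (Fintype.card W)) :
    ∃ (X : Finset W) (𝒞 : Finset (Finset W)), H.IsOddFamily X 𝒞 ∧ X.card + 2 ≤ 𝒞.card ∧
      ∀ x ∈ X, 3 ≤ (𝒞.filter fun C => ∃ c ∈ C, H.Adj x c).card := by
  have hex : ∃ n, ∃ (X : Finset W) (𝒞 : Finset (Finset W)),
      H.IsOddFamily X 𝒞 ∧ X.card < 𝒞.card ∧ X.card = n := by
    have : ∃ u, H.IsTutteViolator u := by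
      by_contra! hu
      obtain ⟨M, hM⟩ := tutte.2 hu
      exact hno M hM
    obtain ⟨u, hu⟩ := this
    obtain ⟨X, 𝒞, h1, h2⟩ := hu.exists_isOddFamily
    exact ⟨_, X, 𝒞, h1, h2, rfl⟩
  classical
  obtain ⟨X, 𝒟, h𝒟, hlt, hX⟩ := Nat.find_spec hex
  obtain ⟨𝒞, h𝒞, hle⟩ := h𝒟.exists_add_two_le hW hlt
  refine ⟨X, 𝒞, h𝒞, hle, fun x hx => ?_⟩
  by_contra! hlt3
  have hcard := Finset.card_erase_add_one hx
  have hsplit := Finset.card_filter_add_card_filter_not (s := 𝒞) (fun C => ∃ c ∈ C, H.Adj x c)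
  exact Nat.find_min hex (m := (X.erase x).card) (by lia) ⟨_, _, h𝒞.erase x, by lia, rfl⟩

end OddFamily
/-- The graph on `k` copies of every vertex and on the darts of `G`, in which a dart is joined to
its reverse and to the copies of its source. Its perfect matchings encode the `k`-factors
of `G`. -/
def factorGadget {V : Type*} (G : SimpleGraph V) (k : ℕ) : SimpleGraph (V × Fin k ⊕ G.Dart) where
  Adj
    | .inl _, .inl _ => False
    | .inl a, .inr d => d.fst = a.1
    | .inr d, .inl a => d.fst = a.1
    | .inr d, .inr e => e = d.symm
  symm := ⟨by
    rintro (a | d) (b | e) h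
    · exact h
    · exact h
    · exact h
    · exact (Dart.symm_symm d ▸ congrArg Dart.symm h).symm⟩
  loopless := ⟨by
    rintro (a | d) h
    · exact h
    · exact d.symm_ne h.symm⟩

section Gadget

variable {V : Type*} {G : SimpleGraph V} {k : ℕ}

@[simp] theorem factorGadget_adj_inl_inl (a b : V × Fin k) :
    ¬ (G.factorGadget k).Adj (.inl a) (.inl b) := id

@[simp] theorem factorGadget_adj_inl_inr (a : V × Fin k) (d : G.Dart) :
    (G.factorGadget k).Adj (.inl a) (.inr d) ↔ d.fst = a.1 := Iff.rfl

@[simp] theorem factorGadget_adj_inr_inl (a : V × Fin k) (d : G.Dart) :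
    (G.factorGadget k).Adj (.inr d) (.inl a) ↔ d.fst = a.1 := Iff.rfl

@[simp] theorem factorGadget_adj_inr_inr (d e : G.Dart) :
    (G.factorGadget k).Adj (.inr d) (.inr e) ↔ e = d.symm := Iff.rfl

theorem exists_factor_of_isPerfectMatching_factorGadget {M : (G.factorGadget k).Subgraph}
    (hM : M.IsPerfectMatching) :
    ∃ F : SimpleGraph V, F ≤ G ∧ ∀ v : V, (F.neighborSet v).ncard = k := by
  let F : SimpleGraph V :=
    { Adj := fun u v => ∃ h : G.Adj u v, ¬ M.Adj (.inr ⟨(u, v), h⟩) (.inr ⟨(v, u), h.symm⟩)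
      symm := ⟨fun u v ⟨h, hn⟩ => ⟨h.symm, fun hm => hn hm.symm⟩⟩
      loopless := ⟨fun u ⟨h, _⟩ => h.ne rfl⟩ }
  refine ⟨F, fun u v h => h.1, fun v => ?_⟩
  have hpartner : ∀ i : Fin k, ∃ d : G.Dart, d.fst = v ∧ M.Adj (.inl (v, i)) (.inr d) := by
    intro i
    obtain ⟨b | d, hw, -⟩ := hM.1 (hM.2 (.inl (v, i)))
    · exact absurd hw.adj_sub (factorGadget_adj_inl_inl _ _)
    · exact ⟨d, hw.adj_sub, hw⟩
  choose f hfv hfM using hpartner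
  have hinj : Function.Injective fun i => (f i).snd := by
    intro i j hij
    have hd : f i = f j := Dart.ext _ _ (Prod.ext ((hfv i).trans (hfv j).symm) hij)
    have := hM.1.eq_of_adj_right (hfM i) (hd ▸ hfM j)
    simpa using this
  have himage : F.neighborSet v = Set.range fun i => (f i).snd := by
    ext u
    constructor
    · rintro ⟨h, hn⟩
      obtain ⟨⟨a, i⟩ | e, hw, -⟩ := hM.1 (hM.2 (.inr ⟨(v, u), h⟩))
      · obtain rfl : v = a := hw.adj_sub
        have := hM.1.eq_of_adj_left hw.symm (hfM i)
        simp only [Sum.inr.injEq] at this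
        exact ⟨i, by simp [← this]⟩
      · obtain rfl : e = Dart.symm ⟨(v, u), h⟩ := hw.adj_sub
        exact absurd hw hn
    · rintro ⟨i, rfl⟩
      have hadj : G.Adj v (f i).snd := by
        have := (f i).adj
        rwa [show (f i).toProd.1 = v from hfv i] at this
      refine ⟨hadj, fun hm => ?_⟩
      have hd : (⟨(v, (f i).snd), hadj⟩ : G.Dart) = f i :=
        Dart.ext _ _ (Prod.ext (hfv i).symm rfl)
      rw [hd] at hm
      have := hM.1.eq_of_adj_left (hfM i).symm hm
      simp at this
  rw [himage, ← Set.image_univ, Set.ncard_image_of_injective _ hinj, Set.ncard_univ,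
    Nat.card_eq_fintype_card, Fintype.card_fin]

theorem even_card_factorGadget [Fintype V] [DecidableEq V] [DecidableRel G.Adj]
    (h : Even (k * Fintype.card V)) : Even (Fintype.card (V × Fin k ⊕ G.Dart)) := by
  rw [Fintype.card_sum, Fintype.card_prod, Fintype.card_fin, dart_card_eq_twice_card_edges,
    mul_comm]
  exact h.add (even_two_mul _)

theorem card_darts_eq_sum_degree [Fintype V] [DecidableEq V] [DecidableRel G.Adj]
    (T : Finset V) :
    (Finset.univ.filter fun d : G.Dart => d.fst ∈ T).card = ∑ v ∈ T, G.degree v := by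
  rw [Finset.card_eq_sum_card_fiberwise (f := fun d : G.Dart => d.fst) (t := T)
    (by intro d hd; simpa using hd)]
  refine Finset.sum_congr rfl fun v hv => ?_
  rw [← G.dart_fst_fiber_card_eq_degree v, Finset.filter_filter]
  congr 1
  ext d
  simp only [Finset.mem_filter, Finset.mem_univ, true_and]
  exact ⟨fun h => h.2, fun h => ⟨h ▸ hv, h⟩⟩

theorem card_darts_le_sum_inter [Fintype V] [DecidableEq V] [DecidableRel G.Adj]
    (S T : Finset V) :
    (Finset.univ.filter fun d : G.Dart => d.fst ∈ T ∧ d.snd ∈ S).card ≤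
      ∑ v ∈ T, (G.neighborFinset v ∩ S).card := by
  rw [Finset.card_eq_sum_card_fiberwise (f := fun d : G.Dart => d.fst) (t := T)
    (by intro d hd; simp at hd; simpa using hd.1)]
  refine Finset.sum_le_sum fun v hv => ?_
  refine Finset.card_le_card_of_injOn (fun d => d.snd) ?_ ?_
  · intro d hd
    obtain ⟨hd', rfl⟩ := Finset.mem_filter.1 (Finset.mem_coe.1 hd)
    simpa using (Finset.mem_filter.1 hd').2.2
  · intro d hd e he hde
    exact Dart.ext _ _ (Prod.ext ((Finset.mem_filter.1 hd).2.trans (Finset.mem_filter.1 he).2.symm)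
      hde)

end Gadget

theorem even_card_of_involution {α : Type*} [DecidableEq α] {s : Finset α} (f : α → α)
    (hmem : ∀ a ∈ s, f a ∈ s) (hne : ∀ a ∈ s, f a ≠ a) (hinv : ∀ a ∈ s, f (f a) = a) :
    Even s.card := by
  have h : ∑ _a ∈ s, (1 : ZMod 2) = 0 :=
    Finset.sum_involution (fun a _ => f a) (fun _ _ => by decide) (fun a ha _ => hne a ha) hmem
      hinv
  rw [Finset.sum_const, nsmul_one, ZMod.natCast_eq_zero_iff_even] at h
  exact h

/-- Disjoint sets `S` and `T` violating Tutte's condition for the existence of a `k`-factor. The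
function `p` is constant on the connected components of `G - (S ∪ T)`, and the colors in `K` are
all attained. -/
structure IsFactorBarrier {V κ : Type*} [Fintype V] [DecidableEq V] (G : SimpleGraph V)
    [DecidableRel G.Adj] (k : ℕ) (S T : Finset V) (p : V → Option κ) (K : Finset κ) : Prop where
  notMem : ∀ v ∈ S, v ∉ T
  const : ∀ u v, u ∉ S → u ∉ T → v ∉ S → v ∉ T → G.Adj u v → p u = p v
  attained : ∀ i ∈ K, ∃ u, u ∉ S ∧ u ∉ T ∧ p u = some i
  count : k * S.card + ∑ v ∈ T, (G.neighborFinset v \ S).card + 2 ≤ k * T.card + K.card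

section Barrier

variable {V : Type*} [DecidableEq V] {G : SimpleGraph V} {k : ℕ}

theorem IsOddFamily.inr_mem_of_inr_mem {X : Finset (V × Fin k ⊕ G.Dart)}
    {𝒞 : Finset (Finset (V × Fin k ⊕ G.Dart))} [DecidableRel (G.factorGadget k).Adj]
    (h : (G.factorGadget k).IsOddFamily X 𝒞)
    (h3 : ∀ x ∈ X, 3 ≤ (𝒞.filter fun C => ∃ c ∈ C, (G.factorGadget k).Adj x c).card)
    {d e : G.Dart} (hde : d.fst = e.fst) (hd : .inr d ∈ X) : .inr e ∈ X := by
  by_contra he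
  refine absurd (h3 _ hd) (not_le.2 (Nat.lt_succ_of_le ?_))
  refine (Finset.card_le_card ?_).trans
    ((h.card_filter_le {.inr e, .inr d.symm}).trans Finset.card_le_two)
  intro C hC
  obtain ⟨hC, c, hc, hadj⟩ := Finset.mem_filter.1 hC
  refine Finset.mem_filter.2 ⟨hC, ?_⟩
  rcases c with a | c
  · refine ⟨.inr e, by simp, h.closed C hC _ hc _ he ?_⟩
    simp only [factorGadget_adj_inr_inl, factorGadget_adj_inl_inr] at hadj ⊢
    exact hde ▸ hadj
  · obtain rfl : c = d.symm := hadj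
    exact ⟨_, by simp, hc⟩

theorem IsOddFamily.inl_mem_of_inl_mem {X : Finset (V × Fin k ⊕ G.Dart)}
    {𝒞 : Finset (Finset (V × Fin k ⊕ G.Dart))} [DecidableRel (G.factorGadget k).Adj]
    (h : (G.factorGadget k).IsOddFamily X 𝒞)
    (h3 : ∀ x ∈ X, 3 ≤ (𝒞.filter fun C => ∃ c ∈ C, (G.factorGadget k).Adj x c).card)
    {v : V} {i j : Fin k} (hi : .inl (v, i) ∈ X) : .inl (v, j) ∈ X := by
  by_contra hj
  refine absurd (h3 _ hi) (not_le.2 (lt_of_le_of_lt ?_ (by norm_num : 1 < 3)))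
  refine (Finset.card_le_card ?_).trans
    ((h.card_filter_le {.inl (v, j)}).trans (Finset.card_singleton _).le)
  intro C hC
  obtain ⟨hC, c, hc, hadj⟩ := Finset.mem_filter.1 hC
  refine Finset.mem_filter.2 ⟨hC, .inl (v, j), by simp, ?_⟩
  rcases c with a | c
  · exact absurd hadj (factorGadget_adj_inl_inl _ _)
  · exact h.closed C hC _ hc _ hj hadj

theorem IsOddFamily.exists_inr_notMem {X : Finset (V × Fin k ⊕ G.Dart)}
    {𝒞 : Finset (Finset (V × Fin k ⊕ G.Dart))} [DecidableRel (G.factorGadget k).Adj]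
    (h : (G.factorGadget k).IsOddFamily X 𝒞)
    (h3 : ∀ x ∈ X, 3 ≤ (𝒞.filter fun C => ∃ c ∈ C, (G.factorGadget k).Adj x c).card)
    {v : V} {i : Fin k} (hi : .inl (v, i) ∈ X) : ∃ d : G.Dart, d.fst = v ∧ .inr d ∉ X := by
  obtain ⟨C, hC⟩ := Finset.card_pos.1 (lt_of_lt_of_le (by norm_num) (h3 _ hi))
  obtain ⟨hC, c | d, hc, hadj⟩ := Finset.mem_filter.1 hC
  · exact absurd hadj (factorGadget_adj_inl_inl _ _)
  · exact ⟨d, hadj, h.notMem C hC _ hc⟩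

variable [Fintype V] [DecidableRel G.Adj]

/-- One direction of Tutte's `k`-factor theorem. -/
theorem exists_isFactorBarrier (hk : 1 ≤ k) (heven : Even (k * Fintype.card V))
    (hno : ¬ ∃ F : SimpleGraph V, F ≤ G ∧ ∀ v : V, (F.neighborSet v).ncard = k) :
    ∃ (S T : Finset V) (p : V → Option (Finset (V × Fin k ⊕ G.Dart)))
      (K : Finset (Finset (V × Fin k ⊕ G.Dart))), G.IsFactorBarrier k S T p K := by
  classical
  obtain ⟨X, 𝒞, h, hle, h3⟩ := exists_isOddFamily_three_le (H := G.factorGadget k)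
    (fun M hM => hno (exists_factor_of_isPerfectMatching_factorGadget hM))
    (even_card_factorGadget heven)
  let i₀ : Fin k := ⟨0, hk⟩
  let S : Finset V := Finset.univ.filter fun v => .inl (v, i₀) ∈ X
  let T : Finset V := Finset.univ.filter fun v => ∀ d : G.Dart, d.fst = v → .inr d ∈ X
  have hS : ∀ v i, .inl (v, i) ∈ X ↔ v ∈ S := fun v i => by
    simp only [S, Finset.mem_filter, Finset.mem_univ, true_and]
    exact ⟨h.inl_mem_of_inl_mem h3, h.inl_mem_of_inl_mem h3⟩
  have hT : ∀ d : G.Dart, .inr d ∈ X ↔ d.fst ∈ T := fun d => by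
    simp only [T, Finset.mem_filter, Finset.mem_univ, true_and]
    exact ⟨fun hd e he => h.inr_mem_of_inr_mem h3 he.symm hd, fun hd => hd d rfl⟩
  have hST : ∀ v ∈ S, v ∉ T := fun v hv hvT => by
    obtain ⟨d, rfl, hd⟩ := h.exists_inr_notMem h3 ((hS v i₀).2 hv)
    exact hd ((hT d).2 hvT)
  have hX : X.card = k * S.card + ∑ v ∈ T, G.degree v := by
    have : X = (S ×ˢ (Finset.univ : Finset (Fin k))).disjSum
        (Finset.univ.filter fun d : G.Dart => d.fst ∈ T) := by
      ext (⟨v, i⟩ | d)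
      · simp [hS]
      · simp [hT]
    rw [this, Finset.card_disjSum, card_darts_eq_sum_degree, Finset.card_product,
      Finset.card_univ, Fintype.card_fin, mul_comm]
  have hinl : ∀ C ∈ 𝒞, ∀ v ∉ T, ∀ i, .inl (v, i) ∈ C → .inl (v, i₀) ∈ C := by
    intro C hC v hv i hi
    have hvS : v ∉ S := fun hvS => h.notMem C hC _ hi ((hS v i).2 hvS)
    obtain ⟨d, rfl, hd⟩ : ∃ d : G.Dart, d.fst = v ∧ .inr d ∉ X := by
      simpa [T] using hv
    have hdC : .inr d ∈ C := h.closed C hC _ hi _ hd rfl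
    exact h.closed C hC _ hdC _ (fun hX => hvS ((hS _ _).1 hX)) rfl
  have hinr : ∀ C ∈ 𝒞, ∀ d : G.Dart, d.fst ∉ S → .inr d ∈ C → .inl (d.fst, i₀) ∈ C := by
    intro C hC d hd hdC
    exact h.closed C hC _ hdC _ (fun hX => hd ((hS _ _).1 hX)) rfl
  have hsymm : ∀ C ∈ 𝒞, ∀ d : G.Dart, d.snd ∉ T → .inr d ∈ C → .inr d.symm ∈ C := by
    intro C hC d hd hdC
    exact h.closed C hC _ hdC _ (fun hX => hd ((hT _).1 hX)) rfl
  have hadj : ∀ C ∈ 𝒞, ∀ u v, u ∉ T → v ∉ S → v ∉ T → G.Adj u v →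
      .inl (u, i₀) ∈ C → .inl (v, i₀) ∈ C := by
    intro C hC u v huT hvS hvT huv hu
    have h1 : .inr ⟨(u, v), huv⟩ ∈ C :=
      h.closed C hC _ hu _ (fun hX => huT ((hT _).1 hX)) rfl
    exact hinr C hC _ hvS (hsymm C hC _ hvT h1)
  let p : V → Option (Finset (V × Fin k ⊕ G.Dart)) := fun v =>
    if hv : ∃ C ∈ 𝒞, .inl (v, i₀) ∈ C then some hv.choose else none
  have hp : ∀ v, ∀ C ∈ 𝒞, .inl (v, i₀) ∈ C → p v = some C := by
    intro v C hC hvC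
    have hv : ∃ C ∈ 𝒞, .inl (v, i₀) ∈ C := ⟨C, hC, hvC⟩
    simp only [p, dif_pos hv, Option.some.injEq]
    exact h.eq_of_mem _ hv.choose_spec.1 _ hC _ hv.choose_spec.2 hvC
  let K : Finset (Finset (V × Fin k ⊕ G.Dart)) :=
    𝒞.filter fun C => ∃ u, u ∉ S ∧ u ∉ T ∧ .inl (u, i₀) ∈ C
  refine ⟨S, T, p, K, hST, ?_, ?_, ?_⟩
  · intro u v huS huT hvS hvT huv
    by_cases hu : ∃ C ∈ 𝒞, .inl (u, i₀) ∈ C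
    · obtain ⟨C, hC, huC⟩ := hu
      rw [hp u C hC huC, hp v C hC (hadj C hC u v huT hvS hvT huv huC)]
    · have hv : ¬ ∃ C ∈ 𝒞, .inl (v, i₀) ∈ C := by
        rintro ⟨C, hC, hvC⟩
        exact hu ⟨C, hC, hadj C hC v u hvT huS huT huv.symm hvC⟩
      simp only [p, dif_neg hu, dif_neg hv]
  · intro C hC
    obtain ⟨hC, u, huS, huT, huC⟩ := Finset.mem_filter.1 hC
    exact ⟨u, huS, huT, hp u C hC huC⟩
  · let D : Finset G.Dart := Finset.univ.filter fun d => d.fst ∈ T ∧ d.snd ∈ S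
    let Z : Finset (V × Fin k ⊕ G.Dart) :=
      (T ×ˢ (Finset.univ : Finset (Fin k))).disjSum (D.image Dart.symm)
    have hsub : 𝒞 ⊆ (𝒞.filter fun C => ∃ z ∈ Z, z ∈ C) ∪ K := by
      intro C hC
      by_contra hnot
      simp only [Finset.mem_union, Finset.mem_filter, hC, true_and, K, not_or, not_exists,
        not_and] at hnot
      obtain ⟨hZ, hU⟩ := hnot
      have hcases : ∀ c ∈ C, ∃ d : G.Dart, c = .inr d ∧ d.fst ∈ S ∧ d.snd ∈ S := by
        rintro (⟨v, i⟩ | d) hc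
        · have hvS : v ∉ S := fun hvS => h.notMem C hC _ hc ((hS v i).2 hvS)
          have hvT : v ∉ T := fun hvT => hZ _ (by simpa [Z] using hvT) hc
          exact absurd (hinl C hC v hvT i hc) (hU v hvS hvT)
        · have h1T : d.fst ∉ T := fun hd => h.notMem C hC _ hc ((hT d).2 hd)
          have h1S : d.fst ∈ S := by
            by_contra hd
            exact hU _ hd h1T (hinr C hC d hd hc)
          have h2T : d.snd ∉ T := fun hd =>
            hZ (.inr d) (by
              simp only [Z, Finset.inr_mem_disjSum, Finset.mem_image]
              exact ⟨d.symm, by simpa [D] using ⟨hd, h1S⟩, d.symm_symm⟩) hc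
          refine ⟨d, rfl, h1S, ?_⟩
          by_contra hd
          exact hU _ hd h2T (hinr C hC d.symm hd (hsymm C hC d h2T hc))
      refine Nat.not_even_iff_odd.2 (h.odd C hC)
        (even_card_of_involution (Sum.map id Dart.symm) ?_ ?_ ?_)
      · intro c hc
        obtain ⟨d, rfl, -, hd⟩ := hcases c hc
        exact hsymm C hC d (hST _ hd) hc
      · intro c hc
        obtain ⟨d, rfl, -⟩ := hcases c hc
        simpa using d.symm_ne
      · intro c hc
        obtain ⟨d, rfl, -⟩ := hcases c hc
        simp
    have hZcard : Z.card ≤ k * T.card + ∑ v ∈ T, (G.neighborFinset v ∩ S).card := by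
      rw [Finset.card_disjSum, Finset.card_product, Finset.card_univ, Fintype.card_fin, mul_comm]
      exact Nat.add_le_add_left (Finset.card_image_le.trans (card_darts_le_sum_inter S T)) _
    have hdeg : ∑ v ∈ T, G.degree v =
        ∑ v ∈ T, (G.neighborFinset v ∩ S).card + ∑ v ∈ T, (G.neighborFinset v \ S).card := by
      rw [← Finset.sum_add_distrib]
      refine Finset.sum_congr rfl fun v _ => ?_
      rw [Finset.card_inter_add_card_sdiff, card_neighborFinset_eq_degree]
    have h1 := (Finset.card_le_card hsub).trans (Finset.card_union_le _ _)
    have h2 := h.card_filter_le Z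
    lia

/-- Among the barriers with fixed colors, one with `T` as small as possible. -/
theorem IsFactorBarrier.exists_minimal {κ : Type*} [DecidableEq κ] {S T : Finset V}
    {p : V → Option κ} {K : Finset κ} (h : G.IsFactorBarrier k S T p K) :
    ∃ (S T : Finset V) (p : V → Option κ) (K : Finset κ), G.IsFactorBarrier k S T p K ∧
      ∀ Y ⊆ T, Y.Nonempty → ∑ v ∈ Y, (G.neighborFinset v \ S).card + 1 ≤ k * Y.card +
        (K.filter fun i => ∃ y ∈ Y, ∃ u, u ∉ S ∧ u ∉ T ∧ G.Adj y u ∧ p u = some i).card := by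
  classical
  have hex : ∃ n, ∃ (S T : Finset V) (p : V → Option κ) (K : Finset κ),
      G.IsFactorBarrier k S T p K ∧ T.card = n := ⟨_, S, T, p, K, h, rfl⟩
  obtain ⟨S, T, p, K, h, hcard⟩ := Nat.find_spec hex
  refine ⟨S, T, p, K, h, fun Y hY hne => ?_⟩
  by_contra! hlt
  let Q : Option κ → Prop := fun o => ∃ y ∈ Y, ∃ u, u ∉ S ∧ u ∉ T ∧ G.Adj y u ∧ p u = o
  let p' : V → Option κ := fun v => if v ∈ Y ∨ Q (p v) then none else p v
  have hYcard := Finset.card_sdiff_add_card_eq_card hY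
  have hYsum := Finset.sum_sdiff (f := fun v => (G.neighborFinset v \ S).card) hY
  have hK := Finset.card_filter_add_card_filter_not (s := K) (fun i => Q (some i))
  have hpos := hne.card_pos
  refine Nat.find_min hex (m := (T \ Y).card) (by lia)
    ⟨S, T \ Y, p', K.filter fun i => ¬ Q (some i), ⟨?_, ?_, ?_, ?_⟩, rfl⟩
  · exact fun v hv hvT => h.notMem v hv (Finset.mem_sdiff.1 hvT).1
  · intro u v huS huT hvS hvT huv
    have hY' : ∀ a b, b ∉ S → b ∉ T \ Y → G.Adj a b → a ∈ Y → p' b = none := by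
      intro a b hbS hbT hab ha
      simp only [p']
      rw [if_pos]
      by_cases hb : b ∈ Y
      · exact .inl hb
      · exact .inr ⟨a, ha, b, hbS, fun hT => hbT (Finset.mem_sdiff.2 ⟨hT, hb⟩), hab, rfl⟩
    have hn : ∀ a ∈ Y, p' a = none := fun a ha => if_pos (.inl ha)
    by_cases hu : u ∈ Y
    · rw [hn u hu, hY' u v hvS hvT huv hu]
    by_cases hv : v ∈ Y
    · rw [hn v hv, hY' v u huS huT huv.symm hv]
    have huT' : u ∉ T := fun hT => huT (Finset.mem_sdiff.2 ⟨hT, hu⟩)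
    have hvT' : v ∉ T := fun hT => hvT (Finset.mem_sdiff.2 ⟨hT, hv⟩)
    simp only [p', hu, hv, h.const u v huS huT' hvS hvT' huv]
  · intro i hi
    obtain ⟨hi, hQ⟩ := Finset.mem_filter.1 hi
    obtain ⟨u, huS, huT, hu⟩ := h.attained i hi
    refine ⟨u, huS, fun hT => huT (Finset.mem_sdiff.1 hT).1, ?_⟩
    simp only [p']
    rw [if_neg, hu]
    rintro (huY | hQ')
    · exact huT (hY huY)
    · exact hQ (hu ▸ hQ')
  · have hcount := h.count
    have h1 : k * (T \ Y).card + k * Y.card = k * T.card := by rw [← mul_add, hYcard]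
    have h2 : (K.filter fun i => Q (some i)).card =
        (K.filter fun i => ∃ y ∈ Y, ∃ u, u ∉ S ∧ u ∉ T ∧ G.Adj y u ∧ p u = some i).card := by
      congr
    lia

end Barrier

section Tough

variable {V : Type*} [Fintype V] {G : SimpleGraph V} {k : ℕ}

theorem card_le_card_connectedComponent_induce {α : Type*} {W : Set V} (c : V → α) (M : Finset α)
    (hconst : ∀ u v, u ∉ W → v ∉ W → G.Adj u v → c u = c v)
    (hatt : ∀ m ∈ M, ∃ u ∉ W, c u = m) :
    M.card ≤ Nat.card (G.induce Wᶜ).ConnectedComponent := by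
  have hreach : ∀ u v : ↥Wᶜ, (G.induce Wᶜ).Reachable u v → c u = c v := by
    rintro u v ⟨w⟩
    induction w with
    | nil => rfl
    | cons h _ ih => exact (hconst _ _ (Set.notMem_of_mem_compl (Subtype.prop _))
        (Set.notMem_of_mem_compl (Subtype.prop _)) h).trans ih
  choose f hfW hfc using fun m : M => hatt m m.2
  rw [← Fintype.card_coe M, ← Nat.card_eq_fintype_card]
  refine Nat.card_le_card_of_injective
    (fun m : M => (G.induce Wᶜ).connectedComponentMk ⟨f m, hfW m⟩) fun m n hmn => ?_
  have := hreach _ _ (ConnectedComponent.exact hmn)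
  exact Subtype.ext ((hfc m).symm.trans (this.trans (hfc n)))

theorem mul_card_le_of_tough
    (htough : ∀ S : Set V, 2 ≤ Nat.card (G.induce Sᶜ).ConnectedComponent →
      k * Nat.card (G.induce Sᶜ).ConnectedComponent ≤ S.ncard)
    {α : Type*} (W : Finset V) (c : V → α) (M : Finset α)
    (hconst : ∀ u v, u ∉ W → v ∉ W → G.Adj u v → c u = c v)
    (hatt : ∀ m ∈ M, ∃ u ∉ W, c u = m) (hM : 2 ≤ M.card) : k * M.card ≤ W.card := by
  have h := card_le_card_connectedComponent_induce (G := G) (W := W) c M hconst hatt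
  rw [← Set.ncard_coe_finset W]
  exact (Nat.mul_le_mul_left k h).trans (htough W (hM.trans h))

variable [DecidableEq V] [DecidableRel G.Adj]

theorem eq_top_or_two_mul_le_degree_of_tough
    (htough : ∀ S : Set V, 2 ≤ Nat.card (G.induce Sᶜ).ConnectedComponent →
      k * Nat.card (G.induce Sᶜ).ConnectedComponent ≤ S.ncard) :
    G = ⊤ ∨ ∀ v, 2 * k ≤ G.degree v := by
  have key : ∀ v w, v ≠ w → ¬ G.Adj v w → 2 * k ≤ G.degree v := by
    intro v w hne hvw
    have := mul_card_le_of_tough htough (G.neighborFinset v) (fun u => decide (u = v))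
      {true, false} ?_ ?_ (by simp)
    · rw [card_neighborFinset_eq_degree, Finset.card_pair (by simp)] at this
      lia
    · intro a b ha hb hab
      rw [mem_neighborFinset] at ha hb
      have hav : a ≠ v := by rintro rfl; exact hb hab
      have hbv : b ≠ v := by rintro rfl; exact ha hab.symm
      simp [hav, hbv]
    · intro m _
      cases m
      · exact ⟨w, by simpa using hvw, by simpa using hne.symm⟩
      · exact ⟨v, by simp, by simp⟩
  by_cases h : ∃ v w, v ≠ w ∧ ¬ G.Adj v w
  · right
    obtain ⟨a, b, hab, hnab⟩ := h
    intro v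
    by_cases hv : ∃ w, v ≠ w ∧ ¬ G.Adj v w
    · obtain ⟨w, h1, h2⟩ := hv
      exact key v w h1 h2
    · push Not at hv
      refine (key a b hab hnab).trans ?_
      have h1 : G.neighborFinset v = Finset.univ.erase v := by
        ext w
        simp only [mem_neighborFinset, Finset.mem_erase, Finset.mem_univ, and_true]
        exact ⟨fun h => h.ne', fun h => hv w h.symm⟩
      rw [← card_neighborFinset_eq_degree G v, h1, Finset.card_erase_of_mem (Finset.mem_univ v),
        Finset.card_univ]
      exact Nat.le_pred_of_lt (G.degree_lt_card_verts a)
  · left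
    push Not at h
    ext v w
    exact ⟨fun hvw => hvw.ne, h v w⟩

/-- A greedily chosen maximal independent set: every vertex outside it has a neighbor in it of no
larger weight. -/
theorem exists_isIndepSet_dominating (G : SimpleGraph V) (d : V → ℕ) (A : Finset V) :
    ∃ I ⊆ A, (∀ u ∈ I, ∀ v ∈ I, ¬ G.Adj u v) ∧ ∀ u ∈ A \ I, ∃ y ∈ I, G.Adj y u ∧ d y ≤ d u := by
  classical
  induction A using Finset.strongInduction with
  | H A ih =>
    obtain rfl | hA := A.eq_empty_or_nonempty
    · exact ⟨∅, by simp⟩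
    obtain ⟨v, hv, hmin⟩ := A.exists_min_image d hA
    obtain ⟨I, hI, hind, hdom⟩ := ih ((A.erase v).filter fun u => ¬ G.Adj v u)
      ((Finset.filter_subset _ _).trans_ssubset (Finset.erase_ssubset hv))
    have hIv : ∀ u ∈ I, ¬ G.Adj v u := fun u hu => (Finset.mem_filter.1 (hI hu)).2
    refine ⟨insert v I, ?_, ?_, ?_⟩
    · intro u hu
      rcases Finset.mem_insert.1 hu with rfl | hu
      · exact hv
      · exact Finset.mem_of_mem_erase (Finset.mem_filter.1 (hI hu)).1
    · intro a ha b hb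
      rcases Finset.mem_insert.1 ha with rfl | haI <;> rcases Finset.mem_insert.1 hb with rfl | hbI
      · exact G.irrefl
      · exact hIv b hbI
      · exact fun h => hIv a haI h.symm
      · exact hind a haI b hbI
    · intro u hu
      simp only [Finset.mem_sdiff, Finset.mem_insert, not_or] at hu
      by_cases hvu : G.Adj v u
      · exact ⟨v, Finset.mem_insert_self _ _, hvu, hmin u hu.1⟩
      · obtain ⟨y, hy, h⟩ := hdom u (by simp [hu, hvu])
        exact ⟨y, Finset.mem_insert_of_mem hy, h⟩

theorem IsFactorBarrier.mul_card_add_card_le {κ : Type*} [DecidableEq κ] {S T I : Finset V}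
    {p : V → Option κ} {K : Finset κ} (h : G.IsFactorBarrier k S T p K)
    (htough : ∀ S : Set V, 2 ≤ Nat.card (G.induce Sᶜ).ConnectedComponent →
      k * Nat.card (G.induce Sᶜ).ConnectedComponent ≤ S.ncard)
    (hIT : I ⊆ T) (hI : ∀ u ∈ I, ∀ v ∈ I, ¬ G.Adj u v) {K₀ : Finset κ}
    (hK₀ : K₀ = K.filter fun i => ¬ ∃ y ∈ I, ∃ u, u ∉ S ∧ u ∉ T ∧ G.Adj y u ∧ p u = some i)
    (h2 : 2 ≤ I.card + K₀.card) :
    k * (I.card + K₀.card) + K.card ≤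
      S.card + (T \ I).card + ∑ y ∈ I, (G.neighborFinset y \ (S ∪ T)).card + K₀.card := by
  classical
  let Q : Option κ → V → Prop := fun o y => y ∈ I ∧ ∃ u, u ∉ S ∧ u ∉ T ∧ G.Adj y u ∧ p u = o
  let x : Option κ → Option V := fun o => if ho : ∃ y, Q o y then some ho.choose else none
  have hx : ∀ o y, x o = some y → Q o y := by
    intro o y hy
    by_cases ho : ∃ y, Q o y
    · simp only [x, dif_pos ho, Option.some.injEq] at hy
      exact hy ▸ ho.choose_spec
    · simp [x, dif_neg ho] at hy
  have hx_none : ∀ o, x o = none → ∀ y, ¬ Q o y := by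
    intro o ho y hy
    have : ∃ y, Q o y := ⟨y, hy⟩
    simp [x, dif_pos this] at ho
  let E : Finset (Σ _ : V, V) := I.sigma fun y => G.neighborFinset y \ (S ∪ T)
  have hE : ∀ e, e ∈ E ↔ e.1 ∈ I ∧ G.Adj e.1 e.2 ∧ e.2 ∉ S ∧ e.2 ∉ T := by
    intro e
    simp [E]
  let N : Finset V := (E.filter fun e => ¬ x (p e.2) = some e.1).image Sigma.snd
  have hN : N.card ≤ (E.filter fun e => ¬ x (p e.2) = some e.1).card := Finset.card_image_le
  have hKadj : (K.filter fun i => ∃ y ∈ I, ∃ u, u ∉ S ∧ u ∉ T ∧ G.Adj y u ∧ p u = some i).card ≤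
      (E.filter fun e => x (p e.2) = some e.1).card := by
    refine Finset.card_le_card_of_forall_subsingleton (fun i e => p e.2 = some i) ?_ ?_
    · intro i hi
      obtain ⟨-, y, hy⟩ := Finset.mem_filter.1 hi
      obtain ⟨z, hz⟩ := Option.ne_none_iff_exists'.1 fun ho => hx_none (some i) ho y hy
      obtain ⟨hzI, u, huS, huT, hzu, hu⟩ := hx _ _ hz
      exact ⟨⟨z, u⟩, Finset.mem_filter.2 ⟨(hE _).2 ⟨hzI, hzu, huS, huT⟩, by simp [hu, hz]⟩, hu⟩
    · intro e _ i hi j hj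
      exact Option.some.inj (hi.2.symm.trans hj.2)
  let c : V → V ⊕ Option κ := fun u =>
    if u ∈ I then .inl u else (x (p u)).elim (.inr (p u)) .inl
  have hcI : ∀ u ∈ I, c u = .inl u := fun u hu => if_pos hu
  have hcU : ∀ u ∉ I, c u = (x (p u)).elim (.inr (p u)) .inl := fun u hu => if_neg hu
  have hcN : ∀ y ∈ I, ∀ u, u ∉ S → u ∉ T → u ∉ N → G.Adj y u → c u = .inl y := by
    intro y hy u huS huT huN hyu
    have : x (p u) = some y := by
      by_contra hne
      exact huN (Finset.mem_image.2
        ⟨⟨y, u⟩, Finset.mem_filter.2 ⟨(hE _).2 ⟨hy, hyu, huS, huT⟩, hne⟩, rfl⟩)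
    rw [hcU u fun hu => huT (hIT hu), this]
    rfl
  have hnotN : ∀ u ∈ T, u ∉ N := by
    intro u hu huN
    obtain ⟨e, he, rfl⟩ := Finset.mem_image.1 huN
    exact ((hE e).1 (Finset.mem_filter.1 he).1).2.2.2 hu
  have hW := mul_card_le_of_tough htough (S ∪ T \ I ∪ N) c
    (I.disjSum (K₀.map Function.Embedding.some)) ?_ ?_
    (by rwa [Finset.card_disjSum, Finset.card_map])
  · have h3 := Finset.card_union_le (S ∪ T \ I) N
    have h4 := Finset.card_union_le S (T \ I)
    have h5 := Finset.card_filter_add_card_filter_not (s := E) (fun e => x (p e.2) = some e.1)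
    have h6 := Finset.card_filter_add_card_filter_not (s := K)
      (fun i => ∃ y ∈ I, ∃ u, u ∉ S ∧ u ∉ T ∧ G.Adj y u ∧ p u = some i)
    have h7 : E.card = ∑ y ∈ I, (G.neighborFinset y \ (S ∪ T)).card := Finset.card_sigma _ _
    rw [Finset.card_disjSum, Finset.card_map] at hW
    rw [← hK₀] at h6
    lia
  · intro u v hu hv huv
    simp only [Finset.mem_union, Finset.mem_sdiff, not_or, not_and, not_not] at hu hv
    by_cases huI : u ∈ I
    · by_cases hvI : v ∈ I
      · exact absurd huv (hI u huI v hvI)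
      · rw [hcI u huI, hcN u huI v hv.1.1 (fun hT => hvI (hv.1.2 hT)) hv.2 huv]
    · by_cases hvI : v ∈ I
      · rw [hcI v hvI, hcN v hvI u hu.1.1 (fun hT => huI (hu.1.2 hT)) hu.2 huv.symm]
      · rw [hcU u huI, hcU v hvI, h.const u v hu.1.1 (fun hT => huI (hu.1.2 hT)) hv.1.1
          (fun hT => hvI (hv.1.2 hT)) huv]
  · rintro (y | o) hm
    · rw [Finset.inl_mem_disjSum] at hm
      refine ⟨y, ?_, hcI y hm⟩
      simp only [Finset.mem_union, Finset.mem_sdiff, not_or, not_and, not_not]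
      exact ⟨⟨fun hS => h.notMem y hS (hIT hm), fun _ => hm⟩, hnotN y (hIT hm)⟩
    · rw [Finset.inr_mem_disjSum, Finset.mem_map] at hm
      obtain ⟨i, hi, rfl⟩ := hm
      rw [hK₀] at hi
      obtain ⟨hi, hnot⟩ := Finset.mem_filter.1 hi
      obtain ⟨u, huS, huT, hu⟩ := h.attained i hi
      refine ⟨u, ?_, ?_⟩
      · simp only [Finset.mem_union, Finset.mem_sdiff, not_or]
        refine ⟨⟨huS, fun hT => huT hT.1⟩, fun huN => hnot ?_⟩
        obtain ⟨e, he, rfl⟩ := Finset.mem_image.1 huN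
        obtain ⟨he1, he2, he3, he4⟩ := (hE e).1 (Finset.mem_filter.1 he).1
        exact ⟨e.1, he1, e.2, he3, he4, he2, hu⟩
      · have : x (some i) = none := by
          by_contra hne
          obtain ⟨y, hy⟩ := Option.ne_none_iff_exists'.1 hne
          exact hnot ⟨y, hx _ _ hy⟩
        rw [hcU u fun hI => huT (hIT hI), hu, this]
        rfl

end Tough

theorem two_mul_card_sdiff_add_le {V : Type*} [DecidableEq V] {G : SimpleGraph V}
    [DecidableRel G.Adj] {k : ℕ} {I A : Finset V} {d a b : V → ℕ} (hIA : I ⊆ A)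
    (hdom : ∀ u ∈ A \ I, ∃ y ∈ I, G.Adj y u ∧ d y ≤ d u) (hd : ∀ v ∈ A, d v ≤ k)
    (hab : ∀ v ∈ I, d v = a v + b v) (ha : ∀ v ∈ I, a v + 1 ≤ k)
    (hcard : ∀ y ∈ I, ((A \ I).filter fun u => G.Adj y u).card ≤ a y) :
    2 * k * (A \ I).card + k * I.card + k * ∑ y ∈ I, b y ≤
      k * (k * I.card) + ∑ v ∈ A, d v := by
  have h1 : ∑ u ∈ A \ I, (2 * k - d u) ≤ ∑ y ∈ I, a y * (2 * k - d y) := by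
    calc ∑ u ∈ A \ I, (2 * k - d u)
        ≤ ∑ u ∈ A \ I, ∑ y ∈ I, if G.Adj y u then 2 * k - d y else 0 := by
          refine Finset.sum_le_sum fun u hu => ?_
          obtain ⟨y, hy, hyu, hle⟩ := hdom u hu
          refine le_trans ?_ (Finset.single_le_sum (fun _ _ => Nat.zero_le _) hy)
          rw [if_pos hyu]
          lia
      _ = ∑ y ∈ I, ((A \ I).filter fun u => G.Adj y u).card * (2 * k - d y) := by
          rw [Finset.sum_comm]
          refine Finset.sum_congr rfl fun y _ => ?_
          rw [← Finset.sum_filter, Finset.sum_const, smul_eq_mul]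
      _ ≤ ∑ y ∈ I, a y * (2 * k - d y) :=
          Finset.sum_le_sum fun y hy => Nat.mul_le_mul_right _ (hcard y hy)
  have h2 : ∑ u ∈ A \ I, (2 * k - d u) + ∑ u ∈ A \ I, d u = 2 * k * (A \ I).card := by
    rw [← Finset.sum_add_distrib, Finset.sum_congr rfl (g := fun _ => 2 * k), Finset.sum_const,
      smul_eq_mul, mul_comm]
    intro u hu
    have := hd u (Finset.mem_sdiff.1 hu).1
    lia
  have h3 : ∑ y ∈ I, a y * (2 * k - d y) + k * I.card + k * ∑ y ∈ I, b y ≤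
      k * (k * I.card) + ∑ y ∈ I, d y := by
    have h4 : ∑ y ∈ I, (a y * (2 * k - d y) + k + k * b y) ≤ ∑ y ∈ I, (k * k + d y) := by
      refine Finset.sum_le_sum fun y hy => ?_
      have hdy := hd y (hIA hy)
      have haby := hab y hy
      obtain ⟨e, he⟩ := Nat.exists_eq_add_of_le hdy
      obtain ⟨f, hf⟩ := Nat.exists_eq_add_of_le (ha y hy)
      have h5 : 2 * k - d y = k + e := by lia
      rw [h5]
      have h6 : b y + e = 1 + f := by lia
      nlinarith [Nat.zero_le (f * e)]
    simp only [Finset.sum_add_distrib, Finset.sum_const, smul_eq_mul, ← Finset.mul_sum] at h4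
    nlinarith
  have h4 := Finset.sum_sdiff (f := d) hIA
  lia

section Main

variable {V κ : Type*} [Fintype V] [DecidableEq V] {G : SimpleGraph V}
  [DecidableRel G.Adj] {k : ℕ} {S T : Finset V} {p : V → Option κ} {K : Finset κ}

theorem IsFactorBarrier.card_sdiff_eq (h : G.IsFactorBarrier k S T p K) (v : V) :
    (G.neighborFinset v \ S).card =
      (G.neighborFinset v ∩ T).card + (G.neighborFinset v \ (S ∪ T)).card := by
  rw [← Finset.card_inter_add_card_sdiff (G.neighborFinset v \ S) T, sdiff_sdiff_left]
  congr 2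
  ext u
  simp only [Finset.mem_inter, Finset.mem_sdiff]
  exact ⟨fun hu => ⟨hu.1.1, hu.2⟩, fun hu => ⟨⟨hu.1, fun hS => h.notMem u hS hu.2⟩, hu.2⟩⟩

variable [DecidableEq κ]

theorem card_adjacent_colors_le (G : SimpleGraph V) [DecidableRel G.Adj] (S T : Finset V)
    (p : V → Option κ) (K : Finset κ) (v : V) :
    (K.filter fun i => ∃ u, u ∉ S ∧ u ∉ T ∧ G.Adj v u ∧ p u = some i).card ≤
      (G.neighborFinset v \ (S ∪ T)).card := by
  refine Finset.card_le_card_of_forall_subsingleton (fun i u => p u = some i) ?_ ?_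
  · intro i hi
    obtain ⟨-, u, huS, huT, hvu, hu⟩ := Finset.mem_filter.1 hi
    exact ⟨u, by simp [huS, huT, hvu], hu⟩
  · intro u _ i hi j hj
    exact Option.some.inj (hi.2.symm.trans hj.2)

theorem IsFactorBarrier.not_minimal_of_tough (h : G.IsFactorBarrier k S T p K)
    (hmin : ∀ Y ⊆ T, Y.Nonempty → ∑ v ∈ Y, (G.neighborFinset v \ S).card + 1 ≤ k * Y.card +
      (K.filter fun i => ∃ y ∈ Y, ∃ u, u ∉ S ∧ u ∉ T ∧ G.Adj y u ∧ p u = some i).card)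
    (htough : ∀ S : Set V, 2 ≤ Nat.card (G.induce Sᶜ).ConnectedComponent →
      k * Nat.card (G.induce Sᶜ).ConnectedComponent ≤ S.ncard)
    (hk : 1 ≤ k) (hV : k + 1 ≤ Fintype.card V) : False := by
  classical
  set d : V → ℕ := fun v => (G.neighborFinset v \ S).card with hd
  set a : V → ℕ := fun v => (G.neighborFinset v ∩ T).card with ha
  set b : V → ℕ := fun v => (G.neighborFinset v \ (S ∪ T)).card with hb
  have hab : ∀ v, d v = a v + b v := h.card_sdiff_eq
  have hak : ∀ v ∈ T, a v + 1 ≤ k := by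
    intro v hv
    have h1 := hmin {v} (by simpa using hv) (by simp)
    have h2 := card_adjacent_colors_le G S T p K v
    simp only [Finset.sum_singleton, Finset.card_singleton, Finset.mem_singleton,
      exists_eq_left] at h1
    have h3 : d v = a v + b v := hab v
    simp only [hd, ha, hb] at h3 ⊢
    lia
  let A : Finset V := T.filter fun v => d v ≤ k
  let B : Finset V := T.filter fun v => ¬ d v ≤ k
  have hABcard : A.card + B.card = T.card := Finset.card_filter_add_card_filter_not _
  have hABsum : ∑ v ∈ A, d v + ∑ v ∈ B, d v = ∑ v ∈ T, d v :=
    Finset.sum_filter_add_sum_filter_not _ _ _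
  have hBsum : (k + 1) * B.card ≤ ∑ v ∈ B, d v := by
    rw [mul_comm, ← smul_eq_mul]
    refine Finset.card_nsmul_le_sum _ _ _ fun v hv => ?_
    have := (Finset.mem_filter.1 hv).2
    lia
  have hBK : B.card ≤ K.card ∧ (B.Nonempty → B.card + 1 ≤ K.card) := by
    have : B.Nonempty → B.card + 1 ≤ K.card := by
      intro hB
      have h1 := (hmin B (Finset.filter_subset _ _) hB).trans
        (Nat.add_le_add_left (Finset.card_filter_le _ _) _)
      have h2 : ∑ v ∈ B, (G.neighborFinset v \ S).card = ∑ v ∈ B, d v := rfl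
      lia
    refine ⟨?_, this⟩
    obtain hB | hB := B.eq_empty_or_nonempty
    · simp [hB]
    · exact (Nat.le_succ _).trans (this hB)
  have hcount : k * S.card + ∑ v ∈ T, d v + 2 ≤ k * T.card + K.card := h.count
  obtain ⟨I, hIA, hind, hdom⟩ := exists_isIndepSet_dominating G d A
  have hAT : A ⊆ T := Finset.filter_subset _ _
  have hdA : ∀ v ∈ A, d v ≤ k := fun v hv => (Finset.mem_filter.1 hv).2
  have hIT : I ⊆ T := hIA.trans hAT
  have hkT : k * T.card = k * A.card + k * B.card := by rw [← mul_add, hABcard]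
  have hIcard := Finset.card_sdiff_add_card_eq_card hIA
  have hTI := Finset.card_sdiff_add_card_eq_card hIT
  by_cases h2 : 2 ≤ I.card +
      (K.filter fun i => ¬ ∃ y ∈ I, ∃ u, u ∉ S ∧ u ∉ T ∧ G.Adj y u ∧ p u = some i).card
  · have h3 := h.mul_card_add_card_le htough hIT hind rfl h2
    set K₀ := K.filter fun i => ¬ ∃ y ∈ I, ∃ u, u ∉ S ∧ u ∉ T ∧ G.Adj y u ∧ p u = some i
    have h4 : k * I.card + K.card ≤ S.card + (B.card + (A \ I).card) + ∑ y ∈ I, b y := by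
      have : K₀.card ≤ k * K₀.card := Nat.le_mul_of_pos_left _ hk
      have h5 : (T \ I).card = B.card + (A \ I).card := by lia
      rw [mul_add, h5] at h3
      simp only [hb]
      lia
    have h5 := two_mul_card_sdiff_add_le hIA hdom hdA (fun v _ => hab v)
      (fun v hv => hak v (hIT hv)) (fun y _ => Finset.card_le_card fun u hu => by
        simp only [Finset.mem_filter, Finset.mem_sdiff] at hu
        simpa using ⟨hu.2, hAT hu.1.1⟩)
    have h6 := Nat.mul_le_mul_left k h4
    have h7 : k * A.card = k * (A \ I).card + k * I.card := by rw [← mul_add, hIcard]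
    obtain ⟨m, rfl⟩ : ∃ m, k = m + 1 := ⟨k - 1, by lia⟩
    have h8 := Nat.mul_le_mul_left m hBK.1
    nlinarith
  · obtain rfl | ⟨v, hv⟩ := I.eq_empty_or_nonempty
    · have hA : A = ∅ := by
        refine Finset.eq_empty_of_forall_notMem fun u hu => ?_
        obtain ⟨y, hy, -⟩ := hdom u (by simpa using hu)
        simp at hy
      have hK : K.card ≤ 1 := by
        simp at h2
        lia
      have hB : B.card = 0 := by
        by_contra hB
        have := hBK.2 (Finset.card_pos.1 (Nat.pos_of_ne_zero hB))
        lia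
      have hT : T.card = 0 := by simp [← hABcard, hA, hB]
      rw [hT] at hcount
      lia
    · have hIone : I.card = 1 := by
        have := Finset.card_pos.2 ⟨v, hv⟩
        lia
      obtain ⟨w, hw⟩ := Finset.card_eq_one.1 hIone
      obtain rfl : v = w := by simpa [hw] using hv
      subst hw
      have hvA : v ∈ A := hIA hv
      have hKb : K.card ≤ b v := by
        have h3 := Finset.card_filter_add_card_filter_not (s := K)
          (fun i => ∃ y ∈ ({v} : Finset V), ∃ u, u ∉ S ∧ u ∉ T ∧ G.Adj y u ∧ p u = some i)
        have h4 := card_adjacent_colors_le G S T p K v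
        simp only [Finset.mem_singleton, exists_eq_left] at h2 h3
        simp only [hb]
        lia
      have hAa : A.card ≤ a v + 1 := by
        rw [← hIcard, hIone]
        refine Nat.add_le_add_right (Finset.card_le_card fun u hu => ?_) 1
        obtain ⟨y, hy, hyu, -⟩ := hdom u hu
        obtain rfl := Finset.mem_singleton.1 hy
        simpa using ⟨hyu, hAT (Finset.mem_sdiff.1 hu).1⟩
      have hAsum : A.card * d v ≤ ∑ u ∈ A, d u := by
        rw [← smul_eq_mul]
        refine Finset.card_nsmul_le_sum _ _ _ fun u hu => ?_
        by_cases huv : u = v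
        · rw [huv]
        · obtain ⟨y, hy, -, hle⟩ := hdom u (by simp [hu, huv])
          obtain rfl := Finset.mem_singleton.1 hy
          exact hle
      have hdeg : G.degree v ≤ S.card + d v := by
        have h3 := Finset.card_sdiff_add_card_inter (G.neighborFinset v) S
        have h4 := Finset.card_le_card (Finset.inter_subset_right (s₁ := G.neighborFinset v)
          (s₂ := S))
        rw [card_neighborFinset_eq_degree] at h3
        simp only [hd]
        lia
      obtain ⟨e, he⟩ := Nat.exists_eq_add_of_le (hdA v hvA)
      have hAk : A.card ≤ k := hAa.trans (hak v (hIT hv))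
      have hAe : k * A.card ≤ ∑ u ∈ A, d u + k * e := by
        have h3 := Nat.mul_le_mul_right e hAk
        have h4 : k * A.card = A.card * d v + A.card * e := by rw [← mul_add, ← he, mul_comm]
        lia
      have hkey : k * S.card + 2 ≤ k * e + K.card := by
        have h3 : (k + 1) * B.card = k * B.card + B.card := by ring
        lia
      have habv := hab v
      rcases eq_top_or_two_mul_le_degree_of_tough htough with hG | hG
      · have hS : e ≤ S.card := by
          have h3 : G.degree v = Fintype.card V - 1 := by
            subst hG
            convert complete_graph_degree v
          lia
        have hK : K.card ≤ 1 := by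
          refine Finset.card_le_one.2 fun i hi j hj => ?_
          obtain ⟨u, huS, huT, hu⟩ := h.attained i hi
          obtain ⟨w, hwS, hwT, hw⟩ := h.attained j hj
          by_cases huw : u = w
          · exact Option.some.inj (hu.symm.trans (huw ▸ hw))
          · have hadj : G.Adj u w := by rw [hG]; exact huw
            exact Option.some.inj (hu.symm.trans
              ((h.const u w huS huT hwS hwT hadj).trans hw))
        have := Nat.mul_le_mul_left k hS
        lia
      · have hS : k + e ≤ S.card := by
          have := hG v
          lia
        have := Nat.mul_le_mul_left k hS
        have : k ≤ k * k := Nat.le_mul_self k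
        rw [mul_add] at *
        lia

end Main

end SimpleGraph


/-- every `k`-tough graph `G` with `k·|V(G)|` even and `|V(G)| ≥ k + 1`
has a `k`-factor. -/
theorem tough_graph_has_k_factor {V : Type*} [Fintype V] (G : SimpleGraph V)
    (k : ℕ) (hk : 1 ≤ k)
    (htough : ∀ S : Set V,
      2 ≤ Nat.card (G.induce Sᶜ).ConnectedComponent →
      k * Nat.card (G.induce Sᶜ).ConnectedComponent ≤ S.ncard)
    (heven : Even (k * Fintype.card V))
    (hcard : k + 1 ≤ Fintype.card V) :
    ∃ F : SimpleGraph V, F ≤ G ∧ ∀ v : V, (F.neighborSet v).ncard = k := by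
  classical
  by_contra hno
  obtain ⟨S, T, p, K, h⟩ := SimpleGraph.exists_isFactorBarrier hk heven hno
  obtain ⟨S, T, p, K, h, hmin⟩ := h.exists_minimal
  exact h.not_minimal_of_tough hmin htough hk hcard
end
end

section
/- Let G[X,Y] be a finite bipartite graph with parts X and Y having no isolated vertices from X, and let k ≥ 1 be an integer. If τ_Y(G) ≥ k, k·|Y| is even, and |Y| ≥ k+1, then G has a (2,k)-factor. -/
noncomputable section

/-- The number of connected components of the strong deletion `G ⊖ S`, the induced subgraph
of `G` on the complement of `S ∪ N_G(S)`. -/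
def cStrong {V : Type*} (G : SimpleGraph V) (S : Set V) : ℕ :=
  Nat.card (G.induce ((S ∪ ⋃ v ∈ S, G.neighborSet v)ᶜ)).ConnectedComponent

section DeletedClasses

open scoped Classical

variable {V : Type*} [Fintype V]

/-- The vertices reachable from `v` by a walk all of whose later vertices avoid `U`; for `v ∉ U`
this is the vertex set of the component of `v` in `H - U`. -/
def deletedClass (H : SimpleGraph V) (U : Finset V) (v : V) : Finset V :=
  Finset.univ.filter fun w => Relation.ReflTransGen (fun a b => H.Adj a b ∧ b ∉ U) v w

/-- The vertex sets of the odd components of `H - U`. -/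
def oddClasses (H : SimpleGraph V) (U : Finset V) : Finset (Finset V) :=
  (Uᶜ.image (deletedClass H U)).filter fun s => Odd s.card

theorem mem_deletedClass_self (H : SimpleGraph V) (U : Finset V) (v : V) :
    v ∈ deletedClass H U v := by
  simp [deletedClass, Relation.ReflTransGen.refl]

theorem deletedClass_subset_of_closed (H : SimpleGraph V) (U : Finset V) {v : V} {P : Finset V}
    (hv : v ∈ P) (hP : ∀ a ∈ P, ∀ b, H.Adj a b → b ∉ U → b ∈ P) : deletedClass H U v ⊆ P := by
  intro w hw
  simp only [deletedClass, Finset.mem_filter, Finset.mem_univ, true_and] at hw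
  induction hw with
  | refl => exact hv
  | tail _ h ih => exact hP _ ih _ h.1 h.2

theorem notMem_of_mem_deletedClass (H : SimpleGraph V) (U : Finset V) {v w : V} (hv : v ∉ U)
    (hw : w ∈ deletedClass H U v) : w ∉ U := by
  have := deletedClass_subset_of_closed H U (P := Uᶜ) (by simpa using hv)
    (fun a _ b _ hb => by simpa using hb) hw
  simpa using this

theorem deletedClass_closed (H : SimpleGraph V) (U : Finset V) {v a b : V}
    (ha : a ∈ deletedClass H U v) (hab : H.Adj a b) (hb : b ∉ U) : b ∈ deletedClass H U v := by
  simp only [deletedClass, Finset.mem_filter, Finset.mem_univ, true_and] at ha ⊢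
  exact ha.tail ⟨hab, hb⟩

theorem deletedClass_eq_of_adj (H : SimpleGraph V) (U : Finset V) {v w : V} (hv : v ∉ U)
    (hw : w ∉ U) (h : H.Adj v w) : deletedClass H U v = deletedClass H U w := by
  apply Finset.Subset.antisymm
  · exact deletedClass_subset_of_closed H U
      (deletedClass_closed H U (mem_deletedClass_self H U w) h.symm hv)
      fun a ha b hab hb => deletedClass_closed H U ha hab hb
  · exact deletedClass_subset_of_closed H U
      (deletedClass_closed H U (mem_deletedClass_self H U v) h hw)
      fun a ha b hab hb => deletedClass_closed H U ha hab hb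

theorem deletedClass_eq_of_mem (H : SimpleGraph V) (U : Finset V) {v w : V} (hv : v ∉ U)
    (hw : w ∈ deletedClass H U v) : deletedClass H U w = deletedClass H U v := by
  have := deletedClass_subset_of_closed H U (v := v)
    (P := Finset.univ.filter fun w => w ∉ U ∧ deletedClass H U w = deletedClass H U v)
    (by simpa using hv) (fun a ha b hab hb => by
      simp only [Finset.mem_filter, Finset.mem_univ, true_and] at ha ⊢
      exact ⟨hb, (deletedClass_eq_of_adj H U ha.1 hb hab).symm.trans ha.2⟩) hw
  simp only [Finset.mem_filter, Finset.mem_univ, true_and] at this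
  exact this.2

theorem odd_card_oddClasses_iff (H : SimpleGraph V) (U : Finset V) :
    Odd (oddClasses H U).card ↔ Odd Uᶜ.card := by
  have h1 : Uᶜ.card = ∑ s ∈ Uᶜ.image (deletedClass H U), s.card := by
    rw [Finset.card_eq_sum_card_fiberwise (f := deletedClass H U)
      (t := Uᶜ.image (deletedClass H U)) fun v hv => Finset.mem_image_of_mem _ hv]
    refine Finset.sum_congr rfl fun s hs => ?_
    obtain ⟨v, hv, rfl⟩ := Finset.mem_image.1 hs
    congr 1
    ext w
    simp only [Finset.mem_filter, Finset.mem_compl] at hv ⊢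
    exact ⟨fun h => h.2 ▸ mem_deletedClass_self H U w,
      fun h => ⟨notMem_of_mem_deletedClass H U hv h, deletedClass_eq_of_mem H U hv h⟩⟩
  rw [h1, Finset.odd_sum_iff_odd_card_odd, oddClasses]

theorem oddClasses_filter_subset (H : SimpleGraph V) (U R : Finset V) :
    (oddClasses H U).filter (fun s => ¬ ∃ u ∈ R, ∃ w ∈ s, H.Adj u w) ⊆ oddClasses H (U \ R) := by
  intro s hs
  simp only [oddClasses, Finset.mem_filter, Finset.mem_image, Finset.mem_compl] at hs ⊢
  obtain ⟨⟨⟨v, hv, rfl⟩, hodd⟩, hR⟩ := hs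
  have : deletedClass H (U \ R) v = deletedClass H U v := by
    apply Finset.Subset.antisymm
    · refine deletedClass_subset_of_closed H _ (mem_deletedClass_self H U v) ?_
      intro a ha b hab hb
      by_cases hbU : b ∈ U
      · have hbR : b ∈ R := by
          by_contra h
          exact hb (Finset.mem_sdiff.2 ⟨hbU, h⟩)
        exact absurd ⟨b, hbR, a, ha, hab.symm⟩ hR
      · exact deletedClass_closed H U ha hab hbU
    · refine deletedClass_subset_of_closed H _ (mem_deletedClass_self H _ v) ?_
      intro a ha b hab hb
      exact deletedClass_closed H _ ha hab fun h => hb (Finset.mem_sdiff.1 h).1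
  exact ⟨⟨v, fun h => hv (Finset.mem_sdiff.1 h).1, this⟩, hodd⟩

theorem ncard_oddComponents_le (H : SimpleGraph V) (U : Set V) :
    ((⊤ : H.Subgraph).deleteVerts U).coe.oddComponents.ncard ≤ (oddClasses H U.toFinset).card := by
  set K := ((⊤ : H.Subgraph).deleteVerts U).coe with hK
  have hadj : ∀ a b, K.Adj a b ↔ H.Adj a.1 b.1 := by
    intro a b
    have ha := a.2
    have hb := b.2
    simp only [SimpleGraph.Subgraph.deleteVerts_verts, Set.mem_sdiff] at ha hb
    simp [hK, ha.2, hb.2]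
  have hreach : ∀ a b, K.Reachable a b → b.1 ∈ deletedClass H U.toFinset a.1 := by
    intro a b h
    rw [SimpleGraph.reachable_iff_reflTransGen] at h
    induction h with
    | refl => exact mem_deletedClass_self _ _ _
    | @tail b c _ h ih =>
      refine deletedClass_closed _ _ ih ((hadj _ _).1 h) ?_
      have hc := c.2
      simp only [SimpleGraph.Subgraph.deleteVerts_verts, Set.mem_sdiff] at hc
      simpa using hc.2
  have hcls : ∀ a, deletedClass H U.toFinset a.1 = (Subtype.val '' (K.connectedComponentMk a).supp).toFinset := by
    intro a
    have ha := a.2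
    simp only [SimpleGraph.Subgraph.deleteVerts_verts, Set.mem_sdiff] at ha
    apply Finset.Subset.antisymm
    · refine deletedClass_subset_of_closed _ _ ?_ ?_
      · simp [ha.2]
      · intro b hb c hbc hc
        simp only [Set.mem_toFinset, Set.mem_image] at hb ⊢
        obtain ⟨b, hb, rfl⟩ := hb
        have hc' : c ∈ ((⊤ : H.Subgraph).deleteVerts U).verts := by simpa using hc
        refine ⟨⟨c, hc'⟩, ?_, rfl⟩
        rw [SimpleGraph.ConnectedComponent.mem_supp_iff] at hb ⊢
        rw [← hb]
        exact SimpleGraph.ConnectedComponent.sound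
          (((hadj b ⟨c, hc'⟩).2 hbc).symm.reachable)
    · intro b hb
      simp only [Set.mem_toFinset, Set.mem_image] at hb
      obtain ⟨b, hb, rfl⟩ := hb
      rw [SimpleGraph.ConnectedComponent.mem_supp_iff] at hb
      exact hreach a b (SimpleGraph.ConnectedComponent.exact hb).symm
  rw [← Set.ncard_coe_finset]
  refine Set.ncard_le_ncard_of_injOn (fun c => (Subtype.val '' c.supp).toFinset) ?_ ?_ (Finset.finite_toSet _)
  · intro c hc
    induction c using SimpleGraph.ConnectedComponent.ind with | _ a => ?_
    have ha := a.2
    simp only [SimpleGraph.Subgraph.deleteVerts_verts, Set.mem_sdiff] at ha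
    simp only [oddClasses, Finset.coe_filter, Set.mem_ofPred_eq, Finset.mem_image]
    refine ⟨⟨a.1, by simpa using ha.2, hcls a⟩, ?_⟩
    have hc' : Odd (K.connectedComponentMk a).supp.ncard := hc
    rwa [← Set.ncard_eq_toFinset_card', Set.ncard_image_of_injective _ Subtype.val_injective]
  · intro c _ c' _ h
    apply SimpleGraph.ConnectedComponent.supp_injective
    apply Set.image_injective.2 Subtype.val_injective
    exact Set.toFinset_inj.1 h

/-- A graph of even order without perfect matching has a barrier all of whose nonempty subsets
`R` have neighbours in at least `|R| + 2` odd components. -/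
theorem exists_surplus_barrier (H : SimpleGraph V) (heven : Even (Fintype.card V))
    (hM : ¬ ∃ M : H.Subgraph, M.IsPerfectMatching) :
    ∃ U : Finset V, U.card + 2 ≤ (oddClasses H U).card ∧
      ∀ R ⊆ U, R.Nonempty →
        R.card + 2 ≤ ((oddClasses H U).filter fun s => ∃ u ∈ R, ∃ w ∈ s, H.Adj u w).card := by
  have hpar : ∀ U : Finset V, (Odd (oddClasses H U).card ↔ Odd U.card) := by
    intro U
    rw [odd_card_oddClasses_iff]
    have := Finset.card_add_card_compl U
    rw [Nat.odd_iff, Nat.odd_iff]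
    rw [Nat.even_iff] at heven
    omega
  obtain ⟨U₀, hU₀⟩ : ∃ U : Finset V, U.card < (oddClasses H U).card := by
    rw [SimpleGraph.tutte] at hM
    push Not at hM
    obtain ⟨U, hU⟩ := hM
    refine ⟨U.toFinset, ?_⟩
    have h1 := ncard_oddComponents_le H U
    rw [SimpleGraph.IsTutteViolator, Set.ncard_eq_toFinset_card'] at hU
    omega
  let f : Finset V → ℤ := fun U =>
    ((oddClasses H U).card - U.card : ℤ) * (Fintype.card V + 1) - U.card
  obtain ⟨U, -, hU⟩ := Finset.exists_max_image Finset.univ f ⟨∅, Finset.mem_univ _⟩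
  have key : ∀ W : Finset V, ((oddClasses H W).card : ℤ) - W.card ≤ (oddClasses H U).card - U.card := by
    intro W
    have h := hU W (Finset.mem_univ _)
    have h1 := Finset.card_le_univ W
    simp only [f] at h
    zify at h1
    by_contra hlt
    push Not at hlt
    nlinarith
  refine ⟨U, ?_, fun R hR hne => ?_⟩
  · have h0 := key U₀
    have h1 := hpar U
    rw [Nat.odd_iff, Nat.odd_iff] at h1
    omega
  · have h1 := hpar U
    have h2 := hpar (U \ R)
    have h3 := Finset.card_le_card (oddClasses_filter_subset H U R)
    have h4 := Finset.card_filter_add_card_filter_not (s := oddClasses H U)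
      (fun s => ∃ u ∈ R, ∃ w ∈ s, H.Adj u w)
    have h5 := Finset.card_sdiff_add_card_eq_card hR
    have h6 := hne.card_pos
    have h7 : ((oddClasses H (U \ R)).card : ℤ) - (U \ R).card < (oddClasses H U).card - U.card := by
      refine lt_of_le_of_ne (key _) fun heq => ?_
      have h := hU (U \ R) (Finset.mem_univ _)
      simp only [f, heq] at h
      omega
    rw [Nat.odd_iff, Nat.odd_iff] at h1 h2
    omega

end DeletedClasses

section SlotBarriers

open scoped Classical

variable {X Y : Type*}

/-- Strong toughness of the hypergraph on `Y` with hyperedges `N x`, phrased through labellings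
`f` that are constant on the hyperedges avoiding `S`. -/
def IsStronglyTough [Fintype Y] (N : X → Finset Y) (k : ℕ) : Prop :=
  ∀ (S : Finset Y) (f : Y → Set Y),
    (∀ x, Disjoint (N x) S → ∀ a ∈ N x, ∀ b ∈ N x, f a = f b) →
    2 ≤ (Sᶜ.image f).card → k * (Sᶜ.image f).card ≤ S.card

theorem IsStronglyTough.le_card [Fintype Y] {N : X → Finset Y} {k : ℕ} (h : IsStronglyTough N k)
    {ι : Type*} [DecidableEq ι] (S : Finset Y) (f : Y → ι)
    (hf : ∀ x, Disjoint (N x) S → ∀ a ∈ N x, ∀ b ∈ N x, f a = f b)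
    {m : ℕ} (hm : 2 ≤ m) (hmf : m ≤ (Sᶜ.image f).card) : k * m ≤ S.card := by
  let g : ι → Set Y := fun i => {y | f y = i}
  have hcard : (Sᶜ.image fun y => g (f y)).card = (Sᶜ.image f).card := by
    have himage : (Sᶜ.image fun y => g (f y)) = (Sᶜ.image f).image g := by
      rw [Finset.image_image]; rfl
    rw [himage, Finset.card_image_of_injOn]
    intro i hi j _ hij
    obtain ⟨y, _, rfl⟩ := Finset.mem_image.1 (Finset.mem_coe.1 hi)
    have : y ∈ g (f y) := rfl
    rw [hij] at this
    exact this
  have := h S (fun y => g (f y)) (fun x hx a ha b hb => by rw [hf x hx a ha b hb])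
    (by omega)
  calc k * m ≤ k * (Sᶜ.image f).card := Nat.mul_le_mul_left _ hmf
    _ ≤ S.card := by rw [← hcard]; exact this

/-- In a strongly tough hypergraph with few vertices every pair is a hyperedge. -/
theorem IsStronglyTough.exists_eq_pair [Fintype Y] {N : X → Finset Y} {k : ℕ}
    (h : IsStronglyTough N k) (hcard : Fintype.card Y ≤ 2 * k + 1) {a b : Y}
    (hab : a ≠ b) : ∃ x, N x = {a, b} := by
  by_contra hno
  push Not at hno
  have hc : ({a, b} : Finset Y)ᶜᶜ.image (id : Y → Y) = {a, b} := by simp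
  have h2 : ({a, b} : Finset Y).card = 2 := Finset.card_pair hab
  have h3 := Finset.card_add_card_compl ({a, b} : Finset Y)
  have := h.le_card ({a, b} : Finset Y)ᶜ (id : Y → Y) (m := 2) (fun x hx u hu v hv => ?_) le_rfl
    (by rw [hc, h2])
  · omega
  · have hsub : N x ⊆ {a, b} := by
      intro w hw
      by_contra hw'
      exact Finset.disjoint_left.1 hx hw (Finset.mem_compl.2 hw')
    by_contra huv
    refine hno x (Finset.eq_of_subset_of_card_le hsub ?_)
    rw [h2, ← Finset.card_pair (a := u) (b := v) (by simpa using huv)]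
    exact Finset.card_le_card (by
      intro w hw
      simp only [Finset.mem_insert, Finset.mem_singleton] at hw
      rcases hw with rfl | rfl <;> assumption)

variable [Fintype X]

/-- In a strongly tough hypergraph every vertex lies in at least `k` hyperedges. -/
theorem IsStronglyTough.le_degree [Fintype Y] {N : X → Finset Y} {k : ℕ} (h : IsStronglyTough N k)
    (hcard : k + 1 ≤ Fintype.card Y) (y : Y) :
    k ≤ (Finset.univ.filter fun x => y ∈ N x).card := by
  by_contra hlt
  push Not at hlt
  let g : X → Y := fun x => if hx : ∃ z ∈ N x, z ≠ y then hx.choose else y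
  have hg : ∀ x, (∃ z ∈ N x, z ≠ y) → g x ∈ N x ∧ g x ≠ y := by
    intro x hx
    simp only [g, dif_pos hx]
    exact hx.choose_spec
  let S : Finset Y := ((Finset.univ.filter fun x => y ∈ N x).image g).erase y
  have hS : S.card < k := lt_of_le_of_lt
    ((Finset.card_le_card (Finset.erase_subset _ _)).trans Finset.card_image_le) hlt
  have hyS : y ∉ S := by simp [S]
  obtain ⟨z, hz⟩ : ∃ z, z ∉ insert y S := by
    by_contra hall
    push Not at hall
    have h1 : (Finset.univ : Finset Y).card ≤ (insert y S).card :=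
      Finset.card_le_card fun z _ => hall z
    have h2 := Finset.card_insert_le y S
    rw [Finset.card_univ] at h1
    omega
  simp only [Finset.mem_insert, not_or] at hz
  have := h.le_card S (fun w => if w = y then y else z) (m := 2) (fun x hx a ha b hb => ?_) le_rfl ?_
  · omega
  · have hmain : y ∈ N x → ∀ c ∈ N x, c = y := by
      intro hy c hc
      by_contra hcy
      have h1 := hg x ⟨c, hc, hcy⟩
      refine Finset.disjoint_left.1 hx h1.1 ?_
      exact Finset.mem_erase.2 ⟨h1.2, Finset.mem_image_of_mem _ (by simpa using hy)⟩
    by_cases hy : y ∈ N x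
    · rw [hmain hy a ha, hmain hy b hb]
    · have h1 : a ≠ y := fun h => hy (h ▸ ha)
      have h2 : b ≠ y := fun h => hy (h ▸ hb)
      simp [h1, h2]
  · exact Finset.one_lt_card.2 ⟨z, Finset.mem_image.2 ⟨z, by simpa using hz.2, by simp [hz.1]⟩, y,
      Finset.mem_image.2 ⟨y, by simpa using hyS, by simp⟩, hz.1⟩

/-- The number of members of the family `sl` that contain `y`. -/
def hyperDegree (sl : X → Finset Y) (y : Y) : ℕ := (Finset.univ.filter fun x => y ∈ sl x).card

/-- The number of two-element slots at `y`. -/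
def pairDegree (sl : X → Finset Y) (y : Y) : ℕ :=
  (Finset.univ.filter fun x => y ∈ sl x ∧ (sl x).card = 2).card

/-- The number of one-element slots at `y`. -/
def singleDegree (sl : X → Finset Y) (y : Y) : ℕ := (Finset.univ.filter fun x => sl x = {y}).card

theorem sum_hyperDegree (sl : X → Finset Y) (T : Finset Y) :
    ∑ y ∈ T, hyperDegree sl y = ∑ x, (sl x ∩ T).card := by
  simp only [hyperDegree, Finset.card_filter]
  rw [Finset.sum_comm]
  refine Finset.sum_congr rfl fun x _ => ?_
  rw [Finset.inter_comm, ← Finset.filter_mem_eq_inter, Finset.card_filter]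

theorem hyperDegree_eq (sl : X → Finset Y) (hsl : ∀ x, (sl x).card ≤ 2) (y : Y) :
    hyperDegree sl y = pairDegree sl y + singleDegree sl y := by
  rw [hyperDegree, pairDegree, singleDegree, ← Finset.card_union_of_disjoint]
  · congr 1
    ext x
    simp only [Finset.mem_filter, Finset.mem_univ, true_and, Finset.mem_union]
    constructor
    · intro h
      have h1 := hsl x
      have h2 : 0 < (sl x).card := Finset.card_pos.2 ⟨y, h⟩
      rcases (by omega : (sl x).card = 2 ∨ (sl x).card = 1) with h3 | h3
      · exact Or.inl ⟨h, h3⟩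
      · obtain ⟨a, ha⟩ := Finset.card_eq_one.1 h3
        rw [ha, Finset.mem_singleton] at h
        exact Or.inr (h ▸ ha)
    · rintro (h | h)
      · exact h.1
      · simp [h]
  · rw [Finset.disjoint_filter]
    rintro x _ ⟨_, h⟩ h'
    simp [h'] at h

theorem pairDegree_le (sl : X → Finset Y) (y : Y) : pairDegree sl y ≤ hyperDegree sl y :=
  Finset.card_le_card (Finset.monotone_filter_right _ fun _ _ h => h.1)

/-- A greedy choice, by increasing slot degree, of a set independent with respect to the
two-element slots. -/
theorem exists_independent_subset (sl : X → Finset Y) (k : ℕ) (R : Finset Y) :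
    ∃ I ⊆ R, (R.Nonempty → I.Nonempty) ∧ (∀ x, (sl x).card = 2 → ¬ sl x ⊆ I) ∧
      ∑ v ∈ R \ I, (2 * k - hyperDegree sl v : ℤ) ≤
        ∑ y ∈ I, ((k - 1) * max (k - hyperDegree sl y : ℤ) 0 + k * pairDegree sl y) := by
  induction R using Finset.strongInduction with
  | H R ih =>
  rcases R.eq_empty_or_nonempty with rfl | hR
  · exact ⟨∅, by simp, by simp, fun x hx h => by
      rw [Finset.subset_empty.1 h] at hx; simp at hx, by simp⟩
  obtain ⟨y, hyR, hy⟩ := Finset.exists_min_image R (hyperDegree sl) hR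
  let W : Finset Y := R.filter fun v => v ≠ y ∧ ∃ x, (sl x).card = 2 ∧ y ∈ sl x ∧ v ∈ sl x
  have hWR : W ⊆ R := Finset.filter_subset _ _
  have hyW : y ∉ W := by simp [W]
  let R' : Finset Y := R \ insert y W
  have hR'R : R' ⊂ R := by
    refine Finset.ssubset_iff_subset_ne.2 ⟨Finset.sdiff_subset, fun h => ?_⟩
    rw [← h] at hyR
    simp [R'] at hyR
  obtain ⟨I, hIR', -, hind, hsum⟩ := ih R' hR'R
  have hyI : y ∉ I := fun h => by
    have := hIR' h
    simp [R'] at this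
  have hWI : ∀ v ∈ W, v ∉ I := fun v hv h => by
    have := hIR' h
    simp [R', hv] at this
  refine ⟨insert y I, Finset.insert_subset hyR (hIR'.trans hR'R.1), fun _ => ⟨y, by simp⟩, ?_, ?_⟩
  · intro x hx hsub
    by_cases hyx : y ∈ sl x
    · obtain ⟨v, hv, hvy⟩ : ∃ v ∈ sl x, v ≠ y :=
        Finset.exists_mem_ne (by omega) y
      have hvI : v ∈ I := (Finset.mem_insert.1 (hsub hv)).resolve_left hvy
      refine hWI v ?_ hvI
      simp only [W, Finset.mem_filter]
      exact ⟨hR'R.1 (hIR' hvI), hvy, x, hx, hyx, hv⟩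
    · exact hind x hx fun v hv => (Finset.mem_insert.1 (hsub hv)).resolve_left
        fun h => hyx (h ▸ hv)
  · have hsplit : R \ insert y I = W ∪ (R' \ I) := by
      ext v
      simp only [R', Finset.mem_sdiff, Finset.mem_insert, Finset.mem_union, not_or]
      constructor
      · rintro ⟨h1, h2, h3⟩
        by_cases hv : v ∈ W
        · exact Or.inl hv
        · exact Or.inr ⟨⟨h1, h2, hv⟩, h3⟩
      · rintro (h | h)
        · exact ⟨hWR h, fun e => hyW (e ▸ h), hWI v h⟩
        · exact ⟨h.1.1, h.1.2.1, h.2⟩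
    have hdisj : Disjoint W (R' \ I) := by
      rw [Finset.disjoint_left]
      intro v hv hv'
      simp [R', hv] at hv'
    rw [hsplit, Finset.sum_union hdisj, Finset.sum_insert hyI]
    refine add_le_add ?_ hsum
    have hW1 : W.card ≤ pairDegree sl y := by
      refine Finset.card_le_card_of_forall_subsingleton (fun v x => v ∈ sl x) ?_ ?_
      · intro v hv
        obtain ⟨-, -, x, hx, hyx, hvx⟩ := Finset.mem_filter.1 hv
        exact ⟨x, by simp [hx, hyx], hvx⟩
      · rintro x hx v ⟨hv, hvx⟩ w ⟨hw, hwx⟩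
        obtain ⟨-, hyx, hx2⟩ := Finset.mem_filter.1 hx
        have hvy : v ≠ y := fun h => hyW (h ▸ hv)
        have hwy : w ≠ y := fun h => hyW (h ▸ hw)
        by_contra hvw
        have : ({y, v, w} : Finset Y).card ≤ (sl x).card := Finset.card_le_card (by
          intro t ht
          simp only [Finset.mem_insert, Finset.mem_singleton] at ht
          rcases ht with rfl | rfl | rfl <;> assumption)
        rw [Finset.card_eq_three.2 ⟨y, v, w, hvy.symm, hwy.symm, hvw, rfl⟩] at this
        omega
    have hW2 : W.card ≤ hyperDegree sl y := hW1.trans (pairDegree_le sl y)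
    have hW3 : ∑ v ∈ W, (2 * k - hyperDegree sl v : ℤ) ≤ W.card * (2 * k - hyperDegree sl y) := by
      rw [← nsmul_eq_mul]
      refine Finset.sum_le_card_nsmul _ _ _ fun v hv => ?_
      have := hy v (hWR hv)
      omega
    refine hW3.trans ?_
    zify at hW1 hW2
    rcases le_total (k : ℤ) (hyperDegree sl y) with hle | hle
    · rw [max_eq_right (by linarith)]
      nlinarith
    · rcases hle.eq_or_lt with heq | hlt
      · rw [max_eq_right (by linarith), heq]
        nlinarith
      rw [max_eq_left (by linarith)]
      have : (W.card : ℤ) ≤ k - 1 := by linarith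
      nlinarith

end SlotBarriers

section SlotBarrierCuts

open scoped Classical

variable {X Y : Type*} [Fintype X]

/-- The combinatorial residue of a barrier in the gadget graph of a hypergraph `N`: deleted
vertices `D`, saturated vertices `T`, odd classes `Q` of the remaining vertices, deleted
hyperedges `A`, and for every hyperedge a slot of at most two saturated vertices. -/
structure SlotBarrier (N : X → Finset Y) (k : ℕ) (L : Type*) where
  D : Finset Y
  T : Finset Y
  lab : Y → L
  Q : Finset L
  A : Finset X
  sl : X → Finset Y
  disjoint : Disjoint D T
  exists_lab : ∀ q ∈ Q, ∃ z, z ∉ D ∧ z ∉ T ∧ lab z = q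
  sl_subset : ∀ x, sl x ⊆ N x
  sl_subset_T : ∀ x, sl x ⊆ T
  sl_of_mem : ∀ x ∈ A, ∃ a ∈ N x, ∃ b ∈ N x, a ≠ b ∧ a ∉ D ∧ b ∉ D ∧
    sl x = ({a, b} : Finset Y).filter (· ∈ T)
  lab_eq : ∀ x ∉ A, ∀ a ∈ N x, ∀ b ∈ N x, a ∉ D → a ∉ T → b ∉ D → b ∉ T → lab a = lab b
  sl_of_notMem : ∀ x ∉ A, (sl x).card = 2 ∨ ((sl x).card ≤ 1 ∧ N x ∩ T = sl x) ∨
    ((N x ∩ T).card ≤ 1 ∧ sl x = ∅ ∧ N x ⊆ D ∪ T)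
  count₁ : k * D.card + ∑ y ∈ T, hyperDegree sl y + ∑ x ∈ A, (2 - (sl x).card) + 2 ≤
    k * T.card + Q.card
  count₂ : ∑ y ∈ T, (hyperDegree sl y - k) + ∑ x ∈ A, (2 - (sl x).card) ≤ Q.card

namespace SlotBarrier

variable {N : X → Finset Y} {k : ℕ} {L : Type*} (B : SlotBarrier N k L)

/-- The deleted hyperedges with empty slot. -/
def emptySlots : Finset X := B.A.filter fun x => B.sl x = ∅

/-- The deleted hyperedges whose slot is a vertex of `I`. -/
def singleSlots (I : Finset Y) : Finset X := B.A.filter fun x => ∃ y ∈ I, B.sl x = {y}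

/-- The class `C` meets a surviving hyperedge whose slot is a vertex of `I`. -/
def Touches (I : Finset Y) (C : L) : Prop :=
  ∃ x ∉ B.A, ∃ y ∈ I, B.sl x = {y} ∧ ∃ z ∈ N x, z ∉ B.D ∧ z ∉ B.T ∧ B.lab z = C

theorem exists_mem_of_card_sl_ne {x : X} (hx : x ∈ B.A) (h2 : (B.sl x).card ≠ 2) :
    (B.sl x).card ≤ 1 ∧ ∃ z ∈ N x, z ∉ B.D ∧ z ∉ B.T := by
  obtain ⟨a, ha, b, hb, hab, haD, hbD, hsl⟩ := B.sl_of_mem x hx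
  have hle : (B.sl x).card ≤ 2 := by
    rw [hsl, ← Finset.card_pair hab]
    exact Finset.card_filter_le _ _
  refine ⟨by omega, ?_⟩
  by_cases haT : a ∈ B.T
  · by_cases hbT : b ∈ B.T
    · rw [hsl, Finset.filter_true_of_mem (by simp [haT, hbT])] at h2
      exact (h2 (Finset.card_pair hab)).elim
    · exact ⟨b, hb, hbD, hbT⟩
  · exact ⟨a, ha, haD, haT⟩

theorem card_sl_le (x : X) : (B.sl x).card ≤ 2 := by
  by_cases hx : x ∈ B.A
  · by_contra h
    have := (B.exists_mem_of_card_sl_ne hx (by omega)).1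
    omega
  · rcases B.sl_of_notMem x hx with h | h | h
    · omega
    · omega
    · simp [h.2.1]

theorem exists_cut [Fintype Y] (htough : IsStronglyTough N k) {I : Finset Y} (hI : I ⊆ B.T)
    (hind : ∀ x, (B.sl x).card = 2 → ¬ B.sl x ⊆ I) (Sv : Finset L)
    (hSv : ∀ C ∈ Sv, B.Touches I C) :
    ∃ (S : Finset Y) (Lost : Finset L), B.T \ I ⊆ S ∧
      S.card + Sv.card ≤ B.D.card + (B.T \ I).card + ∑ y ∈ I, singleDegree B.sl y
        + B.emptySlots.card ∧
      Sv.card ≤ ∑ y ∈ I, singleDegree B.sl y ∧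
      Lost.card ≤ B.emptySlots.card + (B.singleSlots I).card ∧
      (∀ C ∈ B.Q, C ∉ Lost → ¬ B.Touches I C → ∃ z ∉ S, z ∉ B.T ∧ B.lab z = C) ∧
      ∀ M : Finset L, Disjoint M Sv → (∀ C ∈ M, ∃ z ∉ S, z ∉ B.T ∧ B.lab z = C) →
        2 ≤ I.card + M.card → k * (I.card + M.card) ≤ S.card := by
  choose x0 hx0A y0 hy0 hsl0 z0 hz0 hz0D hz0T hz0C using hSv
  let W : Finset X := I.biUnion fun y => Finset.univ.filter fun x => B.sl x = {y}
  have hW : ∀ x, x ∈ W ↔ ∃ y ∈ I, B.sl x = {y} := by simp [W]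
  have hWcard : W.card ≤ ∑ y ∈ I, singleDegree B.sl y := Finset.card_biUnion_le
  let X0 : Finset X := Sv.attach.image fun C => x0 C.1 C.2
  have hX0card : X0.card = Sv.card := by
    rw [Finset.card_image_of_injective, Finset.card_attach]
    rintro ⟨C, hC⟩ ⟨C', hC'⟩ h
    simp only at h
    have := B.lab_eq _ (hx0A C hC) _ (hz0 C hC) _ (h ▸ hz0 C' hC') (hz0D C hC) (hz0T C hC)
      (hz0D C' hC') (hz0T C' hC')
    rw [hz0C, hz0C] at this
    exact Subtype.ext this
  have hX0W : X0 ⊆ W := by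
    intro x hx
    obtain ⟨⟨C, hC⟩, -, rfl⟩ := Finset.mem_image.1 hx
    exact (hW _).2 ⟨_, hy0 C hC, hsl0 C hC⟩
  let P : Finset X := (B.emptySlots ∪ W).filter fun x => ∃ z ∈ N x, z ∉ B.D ∧ z ∉ B.T
  let K : Finset X := P \ X0
  have hKz : ∀ x : K, ∃ z ∈ N x, z ∉ B.D ∧ z ∉ B.T := fun x =>
    (Finset.mem_filter.1 (Finset.mem_sdiff.1 x.2).1).2
  choose kill hkill hkillD hkillT using hKz
  let S : Finset Y := B.D ∪ (B.T \ I) ∪ Finset.univ.image kill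
  let Lost : Finset L := (Finset.univ.filter fun x : K => x.1 ∈ B.A).image fun x => B.lab (kill x)
  have hIS : ∀ y ∈ I, y ∉ S := by
    intro y hy hS
    simp only [S, Finset.mem_union, Finset.mem_sdiff, Finset.mem_image, Finset.mem_univ,
      true_and] at hS
    rcases hS with (h | h) | ⟨x, rfl⟩
    · exact Finset.disjoint_left.1 B.disjoint h (hI hy)
    · exact h.2 hy
    · exact hkillT x (hI hy)
  refine ⟨S, Lost, Finset.subset_union_right.trans Finset.subset_union_left, ?_,
    hX0card ▸ (Finset.card_le_card hX0W).trans hWcard, ?_, ?_, ?_⟩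
  · have h1 : (Finset.univ.image kill).card ≤ K.card := by
      simpa using (Finset.card_image_le (s := Finset.univ) (f := kill))
    have h2 : K.card + Sv.card ≤ B.emptySlots.card + W.card := by
      rw [← hX0card, ← Finset.card_union_of_disjoint Finset.sdiff_disjoint]
      refine (Finset.card_le_card ?_).trans (Finset.card_union_le _ _)
      refine Finset.union_subset (Finset.sdiff_subset.trans (Finset.filter_subset _ _)) ?_
      exact hX0W.trans Finset.subset_union_right
    have h3 : S.card ≤ (B.D ∪ (B.T \ I)).card + (Finset.univ.image kill).card :=
      Finset.card_union_le _ _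
    have h4 := Finset.card_union_le B.D (B.T \ I)
    omega
  · have h1 : Lost.card ≤ (Finset.univ.filter fun x : K => x.1 ∈ B.A).card :=
      Finset.card_image_le
    have h2 : (Finset.univ.filter fun x : K => x.1 ∈ B.A).card ≤
        (B.emptySlots ∪ B.singleSlots I).card := by
      refine Finset.card_le_card_of_injOn Subtype.val ?_ Subtype.val_injective.injOn
      rintro ⟨x, hx⟩ hxA
      have hxA' : x ∈ B.A := by simpa using hxA
      have := (Finset.mem_filter.1 (Finset.mem_sdiff.1 hx).1).1
      simp only [Finset.mem_union, hW] at this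
      simp only [Finset.coe_union, Set.mem_union, Finset.mem_coe, singleSlots, Finset.mem_filter]
      exact this.imp id fun h => ⟨hxA', h⟩
    exact h1.trans (h2.trans (Finset.card_union_le _ _))
  · intro C hC hlost htouch
    obtain ⟨z, hzD, hzT, rfl⟩ := B.exists_lab C hC
    refine ⟨z, fun hS => ?_, hzT, rfl⟩
    simp only [S, Finset.mem_union, Finset.mem_sdiff, Finset.mem_image, Finset.mem_univ,
      true_and] at hS
    rcases hS with (h | h) | ⟨⟨x, hx⟩, rfl⟩
    · exact hzD h
    · exact hzT h.1
    · by_cases hxA : x ∈ B.A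
      · exact hlost (Finset.mem_image.2 ⟨⟨x, hx⟩, by simpa using hxA, rfl⟩)
      · have := (Finset.mem_filter.1 (Finset.mem_sdiff.1 hx).1).1
        simp only [Finset.mem_union, hW, emptySlots, Finset.mem_filter, hxA, false_and,
          false_or] at this
        obtain ⟨y, hy, hxy⟩ := this
        exact htouch ⟨x, hxA, y, hy, hxy, _, hkill ⟨x, hx⟩, hzD, hzT, rfl⟩
  · intro M hM hMz h2
    let g : L → Y ⊕ L := fun C => if h : C ∈ Sv then Sum.inl (y0 C h) else Sum.inr C
    let f : Y → Y ⊕ L := fun y => if y ∈ I then Sum.inl y else g (B.lab y)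
    have hfT : ∀ y, y ∉ B.T → f y = g (B.lab y) := fun y hy => by
      simp only [f, if_neg fun h => hy (hI h)]
    have hsurv : ∀ x, Disjoint (N x) S → ∀ a ∈ N x, a ∉ B.D ∧ (a ∈ B.T → a ∈ I) := by
      intro x hx a ha
      have : a ∉ S := Finset.disjoint_left.1 hx ha
      simp only [S, Finset.mem_union, Finset.mem_sdiff, not_or, not_and, not_not] at this
      exact this.1
    refine htough.le_card S f ?_ h2 ?_
    · intro x hx
      have hx' := hsurv x hx
      have hslI : B.sl x ⊆ I := fun y hy => (hx' y (B.sl_subset x hy)).2 (B.sl_subset_T x hy)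
      have hne2 : (B.sl x).card ≠ 2 := fun h => hind x h hslI
      have hK : x ∉ K := fun h => Finset.disjoint_left.1 hx (hkill ⟨x, h⟩)
        (by simp only [S, Finset.mem_union, Finset.mem_image]; exact Or.inr ⟨_, by simp, rfl⟩)
      have hsmall : (B.sl x).card ≤ 1 → B.sl x = ∅ ∨ ∃ y ∈ I, B.sl x = {y} := by
        intro h
        rcases (B.sl x).eq_empty_or_nonempty with h0 | ⟨y, hy⟩
        · exact Or.inl h0
        · exact Or.inr ⟨y, hslI hy, Finset.eq_singleton_iff_unique_mem.2
            ⟨hy, fun w hw => Finset.card_le_one.1 h w hw y hy⟩⟩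
      by_cases hxA : x ∈ B.A
      · exfalso
        obtain ⟨h1, z, hz, hzD, hzT⟩ := B.exists_mem_of_card_sl_ne hxA hne2
        refine hK (Finset.mem_sdiff.2 ⟨Finset.mem_filter.2 ⟨?_, z, hz, hzD, hzT⟩, ?_⟩)
        · rw [Finset.mem_union, hW, emptySlots, Finset.mem_filter]
          exact (hsmall h1).imp (fun h => ⟨hxA, h⟩) id
        · intro h
          obtain ⟨⟨C, hC⟩, -, rfl⟩ := Finset.mem_image.1 h
          exact hx0A C hC hxA
      rcases (B.sl_of_notMem x hxA).resolve_left hne2 with ⟨h1, hT⟩ | ⟨h1, -, hDT⟩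
      · rcases hsmall h1 with h | ⟨y, hy, hxy⟩
        · intro a ha b hb
          have hnT : ∀ c ∈ N x, c ∉ B.T := fun c hc hcT => by
            have : c ∈ B.sl x := hT ▸ Finset.mem_inter.2 ⟨hc, hcT⟩
            simp [h] at this
          rw [hfT a (hnT a ha), hfT b (hnT b hb), B.lab_eq x hxA a ha b hb (hx' a ha).1 (hnT a ha)
            (hx' b hb).1 (hnT b hb)]
        · suffices ∀ a ∈ N x, f a = Sum.inl y from fun a ha b hb => by rw [this a ha, this b hb]
          intro a ha
          by_cases haT : a ∈ B.T
          · have : a ∈ B.sl x := hT ▸ Finset.mem_inter.2 ⟨ha, haT⟩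
            rw [hxy, Finset.mem_singleton] at this
            simp only [f, this, if_pos hy]
          · have hX0 : x ∈ X0 := by
              by_contra h
              refine hK (Finset.mem_sdiff.2 ⟨Finset.mem_filter.2
                ⟨?_, a, ha, (hx' a ha).1, haT⟩, h⟩)
              exact Finset.mem_union_right _ ((hW x).2 ⟨y, hy, hxy⟩)
            obtain ⟨⟨C, hC⟩, -, rfl⟩ := Finset.mem_image.1 hX0
            have hCa : B.lab a = C := by
              rw [← hz0C C hC]
              exact B.lab_eq _ hxA a ha _ (hz0 C hC) (hx' a ha).1 haT (hz0D C hC) (hz0T C hC)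
            rw [hfT a haT, hCa]
            simp only [g, dif_pos hC]
            have := hsl0 C hC
            rw [hxy] at this
            rw [Finset.singleton_injective this]
      · intro a ha b hb
        have hmem : ∀ c ∈ N x, c ∈ N x ∩ B.T := fun c hc => Finset.mem_inter.2 ⟨hc,
          (Finset.mem_union.1 (hDT hc)).resolve_left (hx' c hc).1⟩
        rw [Finset.card_le_one.1 h1 a (hmem a ha) b (hmem b hb)]
    · rw [← Finset.card_disjSum]
      refine Finset.card_le_card ?_
      intro l hl
      rcases Finset.mem_disjSum.1 hl with ⟨y, hy, rfl⟩ | ⟨C, hC, rfl⟩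
      · exact Finset.mem_image.2 ⟨y, by simpa using hIS y hy, by simp only [f, if_pos hy]⟩
      · obtain ⟨z, hzS, hzT, rfl⟩ := hMz C hC
        refine Finset.mem_image.2 ⟨z, by simpa using hzS, ?_⟩
        rw [hfT z hzT]
        simp only [g, dif_neg (Finset.disjoint_left.1 hM hC)]

theorem card_singleSlots_add_le (I : Finset Y) :
    (B.singleSlots I).card + 2 * B.emptySlots.card ≤ ∑ x ∈ B.A, (2 - (B.sl x).card) := by
  rw [singleSlots, emptySlots, Finset.card_filter, Finset.card_filter, Finset.mul_sum,
    ← Finset.sum_add_distrib]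
  refine Finset.sum_le_sum fun x _ => ?_
  by_cases h0 : B.sl x = ∅
  · have : ¬ ∃ y ∈ I, B.sl x = {y} := by
      rintro ⟨y, -, hy⟩
      simp [h0] at hy
    simp [h0]
  · by_cases h1 : ∃ y ∈ I, B.sl x = {y}
    · obtain ⟨y, hyI, hy⟩ := h1
      simp [hy, hyI]
    · simp [h0, h1]

theorem mem_sl_of_eq_pair {x : X} {y v : Y} (hN : N x = {y, v}) (hyv : y ≠ v) (hy : y ∈ B.T)
    (hv : v ∉ B.D) : y ∈ B.sl x := by
  have hcard : (N x).card = 2 := by rw [hN, Finset.card_pair hyv]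
  by_cases hx : x ∈ B.A
  · obtain ⟨a, ha, b, hb, hab, -, -, hsl⟩ := B.sl_of_mem x hx
    rw [hsl, Finset.mem_filter]
    refine ⟨?_, hy⟩
    rw [Finset.eq_of_subset_of_card_le (s := {a, b}) (t := N x) ?_
      (by rw [hcard, Finset.card_pair hab]), hN]
    · simp
    · intro w hw
      simp only [Finset.mem_insert, Finset.mem_singleton] at hw
      rcases hw with rfl | rfl <;> assumption
  · rcases B.sl_of_notMem x hx with h | h | h
    · rw [Finset.eq_of_subset_of_card_le (B.sl_subset x) (by omega), hN]
      simp
    · rw [← h.2]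
      simp [hN, hy]
    · exfalso
      have hvT : v ∈ B.T := (Finset.mem_union.1 (h.2.2 (by simp [hN]))).resolve_left hv
      exact hyv (Finset.card_le_one.1 h.1 y (by simp [hN, hy]) v (by simp [hN, hvT]))

theorem card_Q_le_of_pairs (hpair : ∀ a b : Y, a ≠ b → ∃ x, N x = {a, b}) :
    B.Q.card ≤ B.emptySlots.card + 1 := by
  rcases B.Q.eq_empty_or_nonempty with h | ⟨q₀, hq₀⟩
  · simp [h]
  rw [← Nat.sub_le_iff_le_add, ← Finset.card_erase_of_mem hq₀]
  obtain ⟨z₀, hz₀D, hz₀T, hz₀⟩ := B.exists_lab q₀ hq₀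
  refine Finset.card_le_card_of_forall_subsingleton
    (fun q x => ∃ z, B.lab z = q ∧ N x = {z₀, z}) ?_ ?_
  · intro q hq
    obtain ⟨hne, hqQ⟩ := Finset.mem_erase.1 hq
    obtain ⟨z, hzD, hzT, hz⟩ := B.exists_lab q hqQ
    have hzz : z₀ ≠ z := fun h => hne (by rw [← hz, ← hz₀, h])
    obtain ⟨x, hx⟩ := hpair z₀ z hzz
    refine ⟨x, Finset.mem_filter.2 ⟨?_, ?_⟩, z, hz, hx⟩
    · by_contra hxA
      have := B.lab_eq x hxA z₀ (by simp [hx]) z (by simp [hx]) hz₀D hz₀T hzD hzT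
      exact hne (by rw [← hz, ← hz₀, this])
    · refine Finset.eq_empty_of_forall_notMem fun w hw => ?_
      have h1 := B.sl_subset x hw
      have h2 := B.sl_subset_T x hw
      rw [hx, Finset.mem_insert, Finset.mem_singleton] at h1
      rcases h1 with rfl | rfl
      · exact hz₀T h2
      · exact hzT h2
  · rintro x _ q ⟨hq, z, hz, hx⟩ q' ⟨hq', z', hz', hx'⟩
    have hne := (Finset.mem_erase.1 hq).1
    have : z ∈ ({z₀, z'} : Finset Y) := by rw [← hx', hx]; simp
    rw [Finset.mem_insert, Finset.mem_singleton] at this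
    rcases this with rfl | rfl
    · exact (hne (by rw [← hz, hz₀])).elim
    · rw [← hz, hz']

theorem false_of_pairs [Fintype Y] (B : SlotBarrier N k L) (hcard : k + 1 ≤ Fintype.card Y)
    (hpair : ∀ a b : Y, a ≠ b → ∃ x, N x = {a, b}) : False := by
  have hdeg : ∀ y ∈ B.T, (Fintype.card Y : ℤ) - 1 - B.D.card ≤ hyperDegree B.sl y := by
    intro y hy
    have h1 : (Finset.univ \ insert y B.D).card ≤ hyperDegree B.sl y := by
      refine Finset.card_le_card_of_forall_subsingleton (fun v x => N x = {y, v}) ?_ ?_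
      · intro v hv
        simp only [Finset.mem_sdiff, Finset.mem_univ, true_and, Finset.mem_insert, not_or] at hv
        obtain ⟨x, hx⟩ := hpair y v (Ne.symm hv.1)
        exact ⟨x, by simpa using B.mem_sl_of_eq_pair hx (Ne.symm hv.1) hy hv.2, hx⟩
      · rintro x _ v ⟨hv, hx⟩ w ⟨-, hx'⟩
        simp only [Finset.mem_sdiff, Finset.mem_univ, true_and, Finset.mem_insert, not_or] at hv
        have : v ∈ ({y, w} : Finset Y) := by rw [← hx', hx]; simp
        rw [Finset.mem_insert, Finset.mem_singleton] at this
        exact this.resolve_left hv.1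
    have h2 := Finset.card_sdiff_add_card_eq_card (Finset.subset_univ (insert y B.D))
    have h3 := Finset.card_insert_le y B.D
    rw [Finset.card_univ] at h2
    omega
  have hsum : (B.T.card : ℤ) * (Fintype.card Y - 1 - B.D.card) ≤
      ∑ y ∈ B.T, (hyperDegree B.sl y : ℤ) := by
    rw [← nsmul_eq_mul]
    exact Finset.card_nsmul_le_sum _ _ _ hdeg
  have hQ := B.card_Q_le_of_pairs hpair
  have hA := B.card_singleSlots_add_le ∅
  have hc := B.count₁
  have hle : B.D.card + B.T.card ≤ Fintype.card Y := by
    rw [← Finset.card_union_of_disjoint B.disjoint]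
    exact Finset.card_le_univ _
  have hmain : (k : ℤ) * B.D.card + B.T.card * (Fintype.card Y - 1 - B.D.card) + 1 ≤
      k * B.T.card := by
    zify at hc
    zify at hQ hA
    nlinarith
  zify at hle hcard
  rcases le_total ((k : ℤ) + 1) (Fintype.card Y - B.D.card) with h | h
  · nlinarith
  · obtain ⟨w, hw⟩ : ∃ w : ℤ, w = k + 1 - (Fintype.card Y - B.D.card) := ⟨_, rfl⟩
    have hw0 : 0 ≤ w := by linarith
    have h1 : (k : ℤ) * w ≤ k * B.D.card := mul_le_mul_of_nonneg_left (by linarith) (by positivity)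
    have h2 : (B.T.card : ℤ) * w ≤ (k + 1 - w) * w := mul_le_mul_of_nonneg_right (by linarith) hw0
    rcases hw0.eq_or_lt with h0 | h0
    · subst h0
      nlinarith
    · have h3 : w * 1 ≤ w * w := mul_le_mul_of_nonneg_left h0 hw0
      have h4 : (B.T.card : ℤ) * w = B.T.card * (k + 1 - (Fintype.card Y - B.D.card)) := by rw [hw]
      nlinarith

theorem isEmpty_of_isStronglyTough [Fintype Y] (htough : IsStronglyTough N k) (hk : 1 ≤ k)
    (hcard : k + 1 ≤ Fintype.card Y) : IsEmpty (SlotBarrier N k L) := by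
  refine ⟨fun B => ?_⟩
  rcases le_or_gt (Fintype.card Y) (2 * k + 1) with hsmall | hbig
  · exact B.false_of_pairs hcard fun a b hab => htough.exists_eq_pair hsmall hab
  obtain ⟨I, hIT, hne, hind, hgreedy⟩ := exists_independent_subset B.sl k B.T
  obtain ⟨S, Lost, -, hS, hqs, hLost, hQ, hcut⟩ := B.exists_cut htough hIT hind
    (B.Q.filter (B.Touches I)) fun C hC => (Finset.mem_filter.1 hC).2
  obtain ⟨S', Lost', hTS', hS', -, -, -, hcut'⟩ := B.exists_cut htough hIT hind ∅ (by simp)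
  obtain ⟨S₀, Lost₀, -, hS₀, -, hLost₀, hQ₀, hcut₀⟩ := B.exists_cut htough (I := ∅) (by simp)
    (fun x hx h => by rw [Finset.subset_empty.1 h] at hx; simp at hx) ∅ (by simp)
  set Sv := B.Q.filter (B.Touches I) with hSv
  let M : Finset L := B.Q \ (Sv ∪ Lost)
  have hSvQ : Sv.card ≤ B.Q.card := Finset.card_filter_le _ _
  have hMcard : B.Q.card ≤ Sv.card + M.card + Lost.card := by
    have h1 : B.Q ⊆ (Sv ∪ Lost) ∪ M := by
      intro q hq
      by_cases h : q ∈ Sv ∪ Lost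
      · exact Finset.mem_union_left _ h
      · exact Finset.mem_union_right _ (Finset.mem_sdiff.2 ⟨hq, h⟩)
    have h2 := Finset.card_le_card h1
    have h3 := Finset.card_union_le (Sv ∪ Lost) M
    have h4 := Finset.card_union_le Sv Lost
    omega
  have hM₀card : B.Q.card ≤ (B.Q \ Lost₀).card + Lost₀.card := by
    have := Finset.le_card_sdiff Lost₀ B.Q
    omega
  have hsplit : B.T.card = (B.T \ I).card + I.card :=
    (Finset.card_sdiff_add_card_eq_card hIT).symm
  have hempty : (B.singleSlots ∅).card = 0 := by simp [singleSlots]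
  have hA := B.card_singleSlots_add_le I
  have hc₁ := B.count₁
  have hc₂ := B.count₂
  have hcutM := hcut M (Finset.disjoint_left.2 fun q hq h =>
    (Finset.mem_sdiff.1 hq).2 (Finset.mem_union_left _ h)) (fun q hq => by
      simp only [M, Sv, Finset.mem_sdiff, Finset.mem_union, Finset.mem_filter, not_or,
        not_and] at hq
      exact hQ q hq.1 hq.2.2 (hq.2.1 hq.1))
  have harith : ¬ k * (I.card + M.card) + Sv.card ≤ B.D.card + (B.T \ I).card +
      ∑ y ∈ I, singleDegree B.sl y + B.emptySlots.card := by
    intro hle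
    have hdeg : ∑ y ∈ I, (hyperDegree B.sl y : ℤ) = ∑ y ∈ I, (pairDegree B.sl y : ℤ) +
        ∑ y ∈ I, (singleDegree B.sl y : ℤ) := by
      rw [← Finset.sum_add_distrib]
      exact Finset.sum_congr rfl fun y _ => by
        rw [hyperDegree_eq _ B.card_sl_le]; push_cast; rfl
    have hPE : ∑ y ∈ I, max (k - hyperDegree B.sl y : ℤ) 0 =
        ∑ y ∈ I, ((hyperDegree B.sl y - k : ℕ) : ℤ) + (k * I.card -
          ∑ y ∈ I, (hyperDegree B.sl y : ℤ)) := by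
      have : (k : ℤ) * I.card = ∑ y ∈ I, (k : ℤ) := by
        rw [Finset.sum_const, nsmul_eq_mul, mul_comm]
      rw [this, ← Finset.sum_sub_distrib, ← Finset.sum_add_distrib]
      exact Finset.sum_congr rfl fun y _ => by omega
    have hE : ∑ y ∈ I, (hyperDegree B.sl y - k) ≤ ∑ y ∈ B.T, (hyperDegree B.sl y - k) :=
      Finset.sum_le_sum_of_subset hIT
    have hdT := Finset.sum_sdiff hIT (f := hyperDegree B.sl)
    rw [Finset.sum_sub_distrib, Finset.sum_add_distrib, ← Finset.mul_sum, ← Finset.mul_sum,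
      ← Finset.mul_sum, Finset.sum_const, nsmul_eq_mul] at hgreedy
    rw [← hdT, hsplit] at hc₁
    have hE' := hE.trans (Nat.le_sub_of_add_le hc₂)
    have hE'' : ∑ y ∈ I, (hyperDegree B.sl y - k) + ∑ x ∈ B.A, (2 - (B.sl x).card) ≤ B.Q.card := by
      omega
    generalize ∑ x ∈ B.A, (2 - (B.sl x).card) = σ at *
    zify at hc₁ hle hE'' hA hLost hMcard hk
    generalize ∑ y ∈ I, (hyperDegree B.sl y : ℤ) = dI at *
    generalize ∑ y ∈ I, (pairDegree B.sl y : ℤ) = pI at *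
    generalize ∑ y ∈ I, (singleDegree B.sl y : ℤ) = sI at *
    generalize ∑ y ∈ B.T \ I, (hyperDegree B.sl y : ℤ) = dR at *
    generalize ∑ y ∈ I, max (k - hyperDegree B.sl y : ℤ) 0 = P at *
    generalize ∑ y ∈ I, ((hyperDegree B.sl y - k : ℕ) : ℤ) = E at *
    subst hPE hdeg
    have h1 := mul_le_mul_of_nonneg_left hle (by linarith : (0 : ℤ) ≤ k)
    have h2 := mul_le_mul_of_nonneg_left hE'' (by linarith : (0 : ℤ) ≤ k - 1)
    have h3 : (k : ℤ) * (B.Q.card + σ) ≤ k * (Sv.card + M.card + σ + σ - B.emptySlots.card) :=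
      mul_le_mul_of_nonneg_left (by linarith) (by linarith)
    have h4 : (0 : ℤ) ≤ k * (k - 1) * M.card := by
      have : (0 : ℤ) ≤ k - 1 := by linarith
      positivity
    nlinarith
  rcases le_or_gt 2 (I.card + M.card) with h2 | h2
  · have := hcutM h2
    exact harith (by omega)
  rcases I.eq_empty_or_nonempty with rfl | hI
  · have hT : B.T = ∅ := by
      by_contra h
      exact absurd (hne (Finset.nonempty_iff_ne_empty.2 h)) (by simp)
    simp only [hT, Finset.card_empty, Finset.sum_empty, mul_zero] at hc₁ hqs
    have := Nat.zero_le (k * B.D.card)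
    simp only [Finset.card_empty] at h2
    omega
  obtain ⟨y, rfl⟩ : ∃ y, I = {y} := by
    have := hI.card_pos
    exact Finset.card_eq_one.1 (by omega)
  have hM0 : M.card = 0 := by rw [Finset.card_singleton] at h2; omega
  rw [hM0] at harith
  simp only [Finset.card_singleton, Finset.card_empty, Finset.sdiff_empty, Finset.sum_empty,
    add_zero, mul_one] at *
  have hqsk : k + 1 ≤ Sv.card := by
    by_cases hz : ∃ z ∉ S', z ∉ B.T
    · obtain ⟨z, hzS, hzT⟩ := hz
      have := hcut' {B.lab z} (by simp) (fun C hC => ⟨z, hzS, hzT, (Finset.mem_singleton.1 hC).symm⟩)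
        (by simp)
      simp only [Finset.card_singleton] at this
      omega
    · have : (Finset.univ : Finset Y) ⊆ insert y S' := by
        intro z _
        by_contra h
        rw [Finset.mem_insert, not_or] at h
        refine hz ⟨z, h.2, fun hzT => h.2 (hTS' ?_)⟩
        simp [hzT, h.1]
      have h1 := Finset.card_le_card this
      have h2 := Finset.card_insert_le y S'
      rw [Finset.card_univ] at h1
      omega
  have hM₀ : (B.Q \ Lost₀).card ≤ 1 := by
    by_contra h
    have h1 := hcut₀ (B.Q \ Lost₀) (by simp) (fun q hq => by
      rw [Finset.mem_sdiff] at hq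
      exact hQ₀ q hq.1 hq.2 (by rintro ⟨x, -, y, hy, -⟩; simp at hy)) (by omega)
    have h2 := Nat.mul_le_mul_left k (show 2 ≤ (B.Q \ Lost₀).card by omega)
    simp only [zero_add] at h1
    omega
  omega

end SlotBarrier

end SlotBarrierCuts

section Gadget

open scoped Classical

variable {X Y : Type*} [Fintype X]

/-- The vertices of the gadget graph: two ends for every hyperedge, one vertex for every incidence,
and `hyperDegree N y - k` cores for every vertex `y`. -/
abbrev GadgetVertex (N : X → Finset Y) (k : ℕ) :=
  (X × Bool) ⊕ ({p : X × Y // p.2 ∈ N p.1} ⊕ (Σ y : Y, Fin (hyperDegree N y - k)))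

/-- Adjacency in the gadget graph. -/
def GadgetAdj (N : X → Finset Y) (k : ℕ) : GadgetVertex N k → GadgetVertex N k → Prop
  | Sum.inl p, Sum.inl q => p.1 = q.1 ∧ p.2 ≠ q.2
  | Sum.inl p, Sum.inr (Sum.inl e) => e.1.1 = p.1
  | Sum.inr (Sum.inl e), Sum.inl p => e.1.1 = p.1
  | Sum.inr (Sum.inl e), Sum.inr (Sum.inr c) => e.1.2 = c.1
  | Sum.inr (Sum.inr c), Sum.inr (Sum.inl e) => e.1.2 = c.1
  | _, _ => False

/-- The gadget graph, whose perfect matchings encode the `(2,k)`-factors of `N`. -/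
def gadgetGraph (N : X → Finset Y) (k : ℕ) : SimpleGraph (GadgetVertex N k) where
  Adj := GadgetAdj N k
  symm := ⟨by
    rintro (p | e | c) (q | e' | c') h <;> simp only [GadgetAdj] at h ⊢
    · exact ⟨h.1.symm, h.2.symm⟩
    all_goals exact h⟩
  loopless := ⟨by rintro (p | e | c) h <;> simp [GadgetAdj] at h⟩

section Adj

variable {N : X → Finset Y} {k : ℕ}

@[simp]
theorem gadgetGraph_adj_end_end {p q : X × Bool} :
    (gadgetGraph N k).Adj (Sum.inl p) (Sum.inl q) ↔ p.1 = q.1 ∧ p.2 ≠ q.2 := Iff.rfl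

@[simp]
theorem gadgetGraph_adj_end_incidence {p : X × Bool} {e : {p : X × Y // p.2 ∈ N p.1}} :
    (gadgetGraph N k).Adj (Sum.inl p) (Sum.inr (Sum.inl e)) ↔ e.1.1 = p.1 := Iff.rfl

@[simp]
theorem gadgetGraph_adj_incidence_end {p : X × Bool} {e : {p : X × Y // p.2 ∈ N p.1}} :
    (gadgetGraph N k).Adj (Sum.inr (Sum.inl e)) (Sum.inl p) ↔ e.1.1 = p.1 := Iff.rfl

@[simp]
theorem gadgetGraph_adj_incidence_core {e : {p : X × Y // p.2 ∈ N p.1}}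
    {c : Σ y : Y, Fin (hyperDegree N y - k)} :
    (gadgetGraph N k).Adj (Sum.inr (Sum.inl e)) (Sum.inr (Sum.inr c)) ↔ e.1.2 = c.1 := Iff.rfl

@[simp]
theorem gadgetGraph_adj_core_incidence {e : {p : X × Y // p.2 ∈ N p.1}}
    {c : Σ y : Y, Fin (hyperDegree N y - k)} :
    (gadgetGraph N k).Adj (Sum.inr (Sum.inr c)) (Sum.inr (Sum.inl e)) ↔ e.1.2 = c.1 := Iff.rfl

@[simp]
theorem gadgetGraph_not_adj_end_core {p : X × Bool} {c : Σ y : Y, Fin (hyperDegree N y - k)} :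
    ¬ (gadgetGraph N k).Adj (Sum.inl p) (Sum.inr (Sum.inr c)) := id

@[simp]
theorem gadgetGraph_not_adj_core_end {p : X × Bool} {c : Σ y : Y, Fin (hyperDegree N y - k)} :
    ¬ (gadgetGraph N k).Adj (Sum.inr (Sum.inr c)) (Sum.inl p) := id

@[simp]
theorem gadgetGraph_not_adj_incidence_incidence {e e' : {p : X × Y // p.2 ∈ N p.1}} :
    ¬ (gadgetGraph N k).Adj (Sum.inr (Sum.inl e)) (Sum.inr (Sum.inl e')) := id

@[simp]
theorem gadgetGraph_not_adj_core_core {c c' : Σ y : Y, Fin (hyperDegree N y - k)} :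
    ¬ (gadgetGraph N k).Adj (Sum.inr (Sum.inr c)) (Sum.inr (Sum.inr c')) := id

end Adj

theorem card_incidence_filter [Fintype Y] (N : X → Finset Y) (D : Finset Y) :
    (Finset.univ.filter fun e : {p : X × Y // p.2 ∈ N p.1} => e.1.2 ∈ D).card =
      ∑ y ∈ D, hyperDegree N y := by
  rw [Finset.card_eq_sum_card_fiberwise (f := fun e => e.1.2) (t := D) (by
    intro e he; simpa using he)]
  refine Finset.sum_congr rfl fun y hy => ?_
  refine Finset.card_bij (fun e _ => e.1.1) ?_ ?_ ?_
  · rintro ⟨⟨x, y'⟩, h⟩ he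
    simp only [Finset.mem_filter, Finset.mem_univ, true_and] at he ⊢
    exact he.2 ▸ h
  · rintro ⟨⟨x, y₁⟩, h₁⟩ he₁ ⟨⟨x', y₂⟩, h₂⟩ he₂ h
    simp only [Finset.mem_filter, Finset.mem_univ, true_and] at he₁ he₂ h
    obtain ⟨-, rfl⟩ := he₁
    obtain ⟨-, rfl⟩ := he₂
    subst h
    rfl
  · intro x hx
    exact ⟨⟨(x, y), by simpa using hx⟩, by simpa using hy, rfl⟩

theorem even_card_gadgetVertex [Fintype Y] {N : X → Finset Y} {k : ℕ}
    (hdeg : ∀ y, k ≤ hyperDegree N y) (heven : Even (k * Fintype.card Y)) :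
    Even (Fintype.card (GadgetVertex N k)) := by
  have h1 := card_incidence_filter N Finset.univ
  simp only [Finset.mem_univ, Finset.filter_true, Finset.card_univ] at h1
  have h2 : ∑ y, (hyperDegree N y - k) + k * Fintype.card Y = ∑ y, hyperDegree N y := by
    rw [mul_comm, ← smul_eq_mul, ← Finset.card_univ, ← Finset.sum_const, ← Finset.sum_add_distrib]
    exact Finset.sum_congr rfl fun y _ => Nat.sub_add_cancel (hdeg y)
  rw [Fintype.card_sum, Fintype.card_sum, Fintype.card_prod, Fintype.card_sigma, h1, ← h2,
    Fintype.card_bool]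
  simp only [Fintype.card_fin]
  obtain ⟨m, hm⟩ := heven
  exact ⟨Fintype.card X + ∑ y, (hyperDegree N y - k) + m, by omega⟩

/-- A perfect matching of the gadget graph yields a `(2,k)`-factor. -/
theorem exists_factor_of_isPerfectMatching {N : X → Finset Y} {k : ℕ}
    (hdeg : ∀ y, k ≤ hyperDegree N y) {M : (gadgetGraph N k).Subgraph}
    (hM : M.IsPerfectMatching) :
    ∃ P : X → Y → Prop, (∀ x y, P x y → y ∈ N x) ∧
      (∀ x, {y | P x y}.ncard = 0 ∨ {y | P x y}.ncard = 2) ∧ ∀ y, {x | P x y}.ncard = k := by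
  have hex : ∀ v, ∃ w, M.Adj v w := fun v => (hM.1 (hM.2 v)).exists
  have huniq : ∀ {v w w'}, M.Adj v w → M.Adj v w' → w = w' := fun {v w w'} h h' =>
    (hM.1 (hM.2 v)).unique h h'
  refine ⟨fun x y => ∃ (h : y ∈ N x) (b : Bool),
    M.Adj (Sum.inl (x, b)) (Sum.inr (Sum.inl ⟨(x, y), h⟩)), fun x y h => h.1, ?_, ?_⟩
  · intro x
    by_cases hx : ∃ b b', M.Adj (Sum.inl (x, b)) (Sum.inl (x, b'))
    · left
      obtain ⟨b, b', hb⟩ := hx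
      have hall : ∀ c, ∃ c', M.Adj (Sum.inl (x, c)) (Sum.inl (x, c')) := by
        intro c
        have hne : b ≠ b' := (gadgetGraph_adj_end_end.1 (M.adj_sub hb)).2
        rcases (by decide : ∀ b b' c : Bool, b ≠ b' → c = b ∨ c = b') b b' c hne
          with rfl | rfl
        · exact ⟨b', hb⟩
        · exact ⟨b, hb.symm⟩
      have : {y | ∃ (h : y ∈ N x) (b : Bool),
          M.Adj (Sum.inl (x, b)) (Sum.inr (Sum.inl ⟨(x, y), h⟩))} = ∅ := by
        refine Set.eq_empty_of_forall_notMem ?_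
        rintro y ⟨h, c, hc⟩
        obtain ⟨c', hc'⟩ := hall c
        have := huniq hc hc'
        simp at this
      rw [this, Set.ncard_empty]
    · right
      have hp : ∀ b, ∃ y, ∃ h : y ∈ N x,
          M.Adj (Sum.inl (x, b)) (Sum.inr (Sum.inl ⟨(x, y), h⟩)) := by
        intro b
        obtain ⟨w, hw⟩ := hex (Sum.inl (x, b))
        have hadj := M.adj_sub hw
        rcases w with ⟨x', b'⟩ | ⟨⟨x', y⟩, h⟩ | c
        · simp at hadj
          obtain ⟨rfl, -⟩ := hadj
          exact (hx ⟨b, b', hw⟩).elim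
        · simp at hadj
          subst hadj
          exact ⟨y, h, hw⟩
        · simp at hadj
      choose p hpN hp using hp
      have hne : p true ≠ p false := by
        intro h
        have h1 := hp true
        have h2 := hp false
        simp only [h] at h1
        have := huniq h1.symm h2.symm
        simp at this
      rw [Set.ncard_eq_two]
      refine ⟨p true, p false, hne, Set.ext fun y => ?_⟩
      simp only [Set.mem_ofPred_eq, Set.mem_insert_iff, Set.mem_singleton_iff]
      constructor
      · rintro ⟨h, b, hb⟩
        have := huniq hb (hp b)
        simp only [Sum.inr.injEq, Sum.inl.injEq, Subtype.mk.injEq, Prod.mk.injEq, true_and] at this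
        cases b
        · exact Or.inr this
        · exact Or.inl this
      · rintro (rfl | rfl)
        · exact ⟨_, _, hp true⟩
        · exact ⟨_, _, hp false⟩
  · intro y
    beta_reduce
    rw [Set.ncard_eq_toFinset_card']
    have hc : ∀ j : Fin (hyperDegree N y - k), ∃ x, ∃ h : y ∈ N x,
        M.Adj (Sum.inr (Sum.inr ⟨y, j⟩)) (Sum.inr (Sum.inl ⟨(x, y), h⟩)) := by
      intro j
      obtain ⟨w, hw⟩ := hex (Sum.inr (Sum.inr ⟨y, j⟩))
      have hadj := M.adj_sub hw
      rcases w with q | ⟨⟨x, y'⟩, h⟩ | c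
      · simp at hadj
      · simp at hadj
        subst hadj
        exact ⟨x, h, hw⟩
      · simp at hadj
    choose ψ hψN hψ using hc
    have hψinj : Function.Injective ψ := by
      intro i j hij
      have h1 := hψ i
      have h2 := hψ j
      simp only [hij] at h1
      have := huniq h1.symm h2.symm
      simpa using this
    have hsplit : (Finset.univ.filter fun x => y ∈ N x) =
        Set.toFinset {x | ∃ (h : y ∈ N x) (b : Bool),
          M.Adj (Sum.inl (x, b)) (Sum.inr (Sum.inl ⟨(x, y), h⟩))} ∪ Finset.univ.image ψ := by
      ext x
      simp only [Finset.mem_filter, Finset.mem_univ, true_and, Finset.mem_union, Set.mem_toFinset,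
        Set.mem_ofPred_eq, Finset.mem_image]
      constructor
      · intro h
        obtain ⟨w, hw⟩ := hex (Sum.inr (Sum.inl ⟨(x, y), h⟩))
        have hadj := M.adj_sub hw
        rcases w with ⟨x', b⟩ | e | ⟨y', j⟩
        · simp at hadj
          subst hadj
          exact Or.inl ⟨h, b, hw.symm⟩
        · simp at hadj
        · simp at hadj
          subst hadj
          refine Or.inr ⟨j, ?_⟩
          have := huniq hw.symm (hψ j)
          simp only [Sum.inr.injEq, Sum.inl.injEq, Subtype.mk.injEq, Prod.mk.injEq, and_true] at this
          exact this.symm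
      · rintro (⟨h, -⟩ | ⟨j, rfl⟩)
        · exact h
        · exact hψN j
    have hdisj : Disjoint (Set.toFinset {x | ∃ (h : y ∈ N x) (b : Bool),
          M.Adj (Sum.inl (x, b)) (Sum.inr (Sum.inl ⟨(x, y), h⟩))}) (Finset.univ.image ψ) := by
      rw [Finset.disjoint_left]
      intro x hx hx'
      obtain ⟨j, -, rfl⟩ := Finset.mem_image.1 hx'
      obtain ⟨h, b, hb⟩ := Set.mem_toFinset.1 hx
      have := huniq hb.symm (hψ j).symm
      simp at this
    have hcard : hyperDegree N y = _ := congrArg Finset.card hsplit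
    rw [Finset.card_union_of_disjoint hdisj, Finset.card_image_of_injective _ hψinj,
      Finset.card_univ, Fintype.card_fin] at hcard
    have := hdeg y
    omega

end Gadget

section SurplusBarrier

open scoped Classical

variable {V : Type*} [Fintype V]

/-- Every nonempty part of `U` meets two more odd classes than it has vertices. -/
def IsSurplusBarrier (H : SimpleGraph V) (U : Finset V) : Prop :=
  U.card + 2 ≤ (oddClasses H U).card ∧ ∀ R ⊆ U, R.Nonempty →
    R.card + 2 ≤ ((oddClasses H U).filter fun s => ∃ u ∈ R, ∃ w ∈ s, H.Adj u w).card

theorem exists_of_mem_oddClasses {H : SimpleGraph V} {U : Finset V} {s : Finset V}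
    (hs : s ∈ oddClasses H U) : ∃ v ∉ U, deletedClass H U v = s := by
  obtain ⟨v, hv, rfl⟩ := Finset.mem_image.1 (Finset.mem_filter.1 hs).1
  exact ⟨v, Finset.mem_compl.1 hv, rfl⟩

theorem mem_of_mem_oddClasses {H : SimpleGraph V} {U : Finset V} {s : Finset V}
    (hs : s ∈ oddClasses H U) {w : V} (hw : w ∈ s) : w ∉ U ∧ deletedClass H U w = s := by
  obtain ⟨v, hv, rfl⟩ := exists_of_mem_oddClasses hs
  exact ⟨notMem_of_mem_deletedClass H U hv hw, deletedClass_eq_of_mem H U hv hw⟩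

namespace IsSurplusBarrier

variable {H : SimpleGraph V} {U : Finset V}

/-- The surviving neighbours of a barrier vertex are not covered by two classes. -/
theorem exists_ne_of_eq (hU : IsSurplusBarrier H U) {u : V} (hu : u ∈ U) (kind : V → Bool) :
    ∃ v w, H.Adj u v ∧ H.Adj u w ∧ v ∉ U ∧ w ∉ U ∧ kind v = kind w ∧
      deletedClass H U v ≠ deletedClass H U w := by
  have h3 := hU.2 {u} (by simpa using hu) (by simp)
  rw [Finset.card_singleton] at h3
  obtain ⟨a, ha, b, hb, c, hc, hab, hac, hbc⟩ := Finset.two_lt_card.1 h3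
  have key : ∀ s, (s ∈ oddClasses H U ∧ ∃ u' ∈ ({u} : Finset V), ∃ w ∈ s, H.Adj u' w) →
      ∃ v, H.Adj u v ∧ v ∉ U ∧ deletedClass H U v = s := by
    rintro s ⟨hs, u', hu', v, hv, huv⟩
    rw [Finset.mem_singleton] at hu'
    subst hu'
    exact ⟨v, huv, mem_of_mem_oddClasses hs hv⟩
  obtain ⟨v₁, h₁, n₁, rfl⟩ := key a (Finset.mem_filter.1 ha)
  obtain ⟨v₂, h₂, n₂, rfl⟩ := key b (Finset.mem_filter.1 hb)
  obtain ⟨v₃, h₃, n₃, rfl⟩ := key c (Finset.mem_filter.1 hc)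
  rcases (by decide : ∀ p q r : Bool, p = q ∨ p = r ∨ q = r) (kind v₁) (kind v₂) (kind v₃)
    with h | h | h
  · exact ⟨v₁, v₂, h₁, h₂, n₁, n₂, h, hab⟩
  · exact ⟨v₁, v₃, h₁, h₃, n₁, n₃, h, hac⟩
  · exact ⟨v₂, v₃, h₂, h₃, n₂, n₃, h, hbc⟩

/-- Barrier vertices can be assigned neighbours in distinct odd classes. -/
theorem exists_transversal (hU : IsSurplusBarrier H U) : ∃ w : V → V,
    (∀ u ∈ U, H.Adj u (w u) ∧ w u ∉ U ∧ deletedClass H U (w u) ∈ oddClasses H U) ∧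
      ∀ u ∈ U, ∀ u' ∈ U, deletedClass H U (w u) = deletedClass H U (w u') → u = u' := by
  obtain ⟨f, hf, hft⟩ := (Finset.all_card_le_biUnion_card_iff_exists_injective
    (fun u : U => (oddClasses H U).filter fun s => ∃ w ∈ s, H.Adj u w)).1 (by
      intro R
      rcases R.eq_empty_or_nonempty with rfl | hR
      · simp
      have h := hU.2 (R.map (Function.Embedding.subtype _)) (by
        intro u hu
        obtain ⟨u', -, rfl⟩ := Finset.mem_map.1 hu
        exact u'.2) (by simpa using hR)
      rw [Finset.card_map] at h
      refine ((Nat.le_add_right _ 2).trans h).trans (Finset.card_le_card ?_)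
      intro s hs
      obtain ⟨hs, u, hu, hw⟩ := Finset.mem_filter.1 hs
      obtain ⟨u', hu', rfl⟩ := Finset.mem_map.1 hu
      exact Finset.mem_biUnion.2 ⟨u', hu', Finset.mem_filter.2 ⟨hs, hw⟩⟩)
  have hex : ∀ u, ∃ w, ∀ hu : u ∈ U, H.Adj u w ∧ w ∈ f ⟨u, hu⟩ := by
    intro u
    by_cases hu : u ∈ U
    · obtain ⟨-, w, hw, huw⟩ := Finset.mem_filter.1 (hft ⟨u, hu⟩)
      exact ⟨w, fun _ => ⟨huw, hw⟩⟩
    · exact ⟨u, fun h => (hu h).elim⟩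
  choose w hw using hex
  have hclass : ∀ u (hu : u ∈ U), w u ∉ U ∧ deletedClass H U (w u) = f ⟨u, hu⟩ := fun u hu =>
    mem_of_mem_oddClasses (Finset.mem_filter.1 (hft ⟨u, hu⟩)).1 (hw u hu).2
  refine ⟨w, fun u hu => ⟨(hw u hu).1, (hclass u hu).1, ?_⟩, fun u hu u' hu' h => ?_⟩
  · rw [(hclass u hu).2]
    exact (Finset.mem_filter.1 (hft ⟨u, hu⟩)).1
  · rw [(hclass u hu).2, (hclass u' hu').2] at h
    exact congrArg Subtype.val (hf h)

end IsSurplusBarrier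

end SurplusBarrier

section GadgetBarrier

open scoped Classical

variable {X Y : Type*} [Fintype X] [Fintype Y] {N : X → Finset Y} {k : ℕ}

/-- The vertices with a deleted incidence. -/
def cutVertices (U : Finset (GadgetVertex N k)) : Finset Y :=
  Finset.univ.filter fun y => ∃ x, ∃ h : y ∈ N x, Sum.inr (Sum.inl ⟨(x, y), h⟩) ∈ U

/-- The vertices without deleted incidence all of whose cores are deleted. -/
def tightVertices (U : Finset (GadgetVertex N k)) : Finset Y :=
  Finset.univ.filter fun y => y ∉ cutVertices U ∧ ∀ j, Sum.inr (Sum.inr ⟨y, j⟩) ∈ U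

/-- The hyperedges whose ends are deleted. -/
def cutEdges (U : Finset (GadgetVertex N k)) : Finset X :=
  Finset.univ.filter fun x => Sum.inl (x, false) ∈ U

/-- The class of the incidences at a vertex. -/
def vertexClass (U : Finset (GadgetVertex N k)) (y : Y) : Finset (GadgetVertex N k) :=
  if h : ∃ x, y ∈ N x then
    deletedClass (gadgetGraph N k) U (Sum.inr (Sum.inl ⟨(h.choose, y), h.choose_spec⟩))
  else ∅

variable {U : Finset (GadgetVertex N k)}

theorem end_mem_iff (hU : IsSurplusBarrier (gadgetGraph N k) U) (x : X) (b : Bool) :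
    Sum.inl (x, b) ∈ U ↔ x ∈ cutEdges U := by
  have key : ∀ b b' : Bool, Sum.inl (x, b) ∈ U → Sum.inl (x, b') ∈ U := by
    intro b b' hb
    by_contra hb'
    have hbb : b ≠ b' := fun h => hb' (h ▸ hb)
    have hclass : ∀ v, (gadgetGraph N k).Adj (Sum.inl (x, b)) v → v ∉ U →
        deletedClass (gadgetGraph N k) U v = deletedClass (gadgetGraph N k) U (Sum.inl (x, b')) := by
      rintro (⟨x', c⟩ | e | c) hv hvU
      · simp only [gadgetGraph_adj_end_end] at hv
        obtain ⟨rfl, hc⟩ := hv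
        rw [(by decide : ∀ p q r : Bool, p ≠ q → p ≠ r → r = q) b b' c hbb hc]
      · exact deletedClass_eq_of_adj _ _ hvU hb' (by simpa using hv)
      · simp at hv
    obtain ⟨v, w, hv, hw, hvU, hwU, -, hne⟩ := hU.exists_ne_of_eq hb fun _ => true
    exact hne ((hclass v hv hvU).trans (hclass w hw hwU).symm)
  simp only [cutEdges, Finset.mem_filter, Finset.mem_univ, true_and]
  exact ⟨key _ _, key _ _⟩

theorem incidence_mem_iff (hU : IsSurplusBarrier (gadgetGraph N k) U) {x : X} {y : Y}
    (h : y ∈ N x) : Sum.inr (Sum.inl ⟨(x, y), h⟩) ∈ U ↔ y ∈ cutVertices U := by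
  simp only [cutVertices, Finset.mem_filter, Finset.mem_univ, true_and]
  refine ⟨fun hm => ⟨x, h, hm⟩, ?_⟩
  rintro ⟨x', h', hm⟩
  by_contra hno
  obtain ⟨v, w, hv, hw, hvU, hwU, hkind, hne⟩ := hU.exists_ne_of_eq hm Sum.isLeft
  refine hne ?_
  rcases v with ⟨x₁, b₁⟩ | e₁ | ⟨y₁, j₁⟩ <;> rcases w with ⟨x₂, b₂⟩ | e₂ | ⟨y₂, j₂⟩
  case inl.inl =>
    simp only [gadgetGraph_adj_incidence_end] at hv hw
    subst hv hw
    by_cases hb : b₁ = b₂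
    · rw [hb]
    · exact deletedClass_eq_of_adj _ _ hvU hwU (by simpa using hb)
  case inr.inr.inr.inr =>
    simp only [gadgetGraph_adj_incidence_core] at hv hw
    subst hv hw
    exact (deletedClass_eq_of_adj _ _ hvU hno (by simp)).trans
      (deletedClass_eq_of_adj _ _ hwU hno (by simp)).symm
  all_goals simp at hv hw hkind

theorem core_notMem (hU : IsSurplusBarrier (gadgetGraph N k) U) {y : Y} (hy : y ∉ tightVertices U)
    (j : Fin (hyperDegree N y - k)) : Sum.inr (Sum.inr ⟨y, j⟩) ∉ U := by
  intro hj
  by_cases hD : y ∈ cutVertices U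
  · obtain ⟨v, w, hv, hw, hvU, hwU, -, hne⟩ := hU.exists_ne_of_eq hj fun _ => true
    rcases v with p | ⟨⟨x, y'⟩, h⟩ | c
    · simp at hv
    · simp only [gadgetGraph_adj_core_incidence] at hv
      subst hv
      exact hvU ((incidence_mem_iff hU h).2 hD)
    · simp at hv
  · simp only [tightVertices, Finset.mem_filter, Finset.mem_univ, true_and, not_and,
      not_forall] at hy
    obtain ⟨i, hi⟩ := hy hD
    have hclass : ∀ v, (gadgetGraph N k).Adj (Sum.inr (Sum.inr ⟨y, j⟩)) v → v ∉ U →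
        deletedClass (gadgetGraph N k) U v =
          deletedClass (gadgetGraph N k) U (Sum.inr (Sum.inr ⟨y, i⟩)) := by
      rintro (p | e | c) hv hvU
      · simp at hv
      · exact deletedClass_eq_of_adj _ _ hvU hi (by simpa using hv)
      · simp at hv
    obtain ⟨v, w, hv, hw, hvU, hwU, -, hne⟩ := hU.exists_ne_of_eq hj fun _ => true
    exact hne ((hclass v hv hvU).trans (hclass w hw hwU).symm)

theorem core_mem {y : Y} (hy : y ∈ tightVertices U) (j : Fin (hyperDegree N y - k)) :
    Sum.inr (Sum.inr ⟨y, j⟩) ∈ U := (Finset.mem_filter.1 hy).2.2 j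

theorem disjoint_cutVertices_tightVertices : Disjoint (cutVertices U) (tightVertices U) :=
  Finset.disjoint_left.2 fun _ h h' => (Finset.mem_filter.1 h').2.1 h

theorem class_incidence_eq_core (hU : IsSurplusBarrier (gadgetGraph N k) U) {x : X} {y : Y}
    (h : y ∈ N x) (hD : y ∉ cutVertices U) (hT : y ∉ tightVertices U)
    (j : Fin (hyperDegree N y - k)) :
    deletedClass (gadgetGraph N k) U (Sum.inr (Sum.inl ⟨(x, y), h⟩)) =
      deletedClass (gadgetGraph N k) U (Sum.inr (Sum.inr ⟨y, j⟩)) :=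
  deletedClass_eq_of_adj _ _ (fun hm => hD ((incidence_mem_iff hU h).1 hm)) (core_notMem hU hT j)
    (by simp)

theorem class_incidence_eq_vertexClass (hU : IsSurplusBarrier (gadgetGraph N k) U) {x : X} {y : Y}
    (h : y ∈ N x) (hD : y ∉ cutVertices U) (hT : y ∉ tightVertices U) :
    deletedClass (gadgetGraph N k) U (Sum.inr (Sum.inl ⟨(x, y), h⟩)) = vertexClass U y := by
  have hex : ∃ x, y ∈ N x := ⟨x, h⟩
  rw [vertexClass, dif_pos hex]
  have hT' := hT
  simp only [tightVertices, Finset.mem_filter, Finset.mem_univ, true_and, not_and,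
    not_forall] at hT'
  obtain ⟨j, -⟩ := hT' hD
  rw [class_incidence_eq_core hU h hD hT j, class_incidence_eq_core hU hex.choose_spec hD hT j]

theorem class_incidence_eq_end (hU : IsSurplusBarrier (gadgetGraph N k) U) {x : X} {y : Y}
    (h : y ∈ N x) (hD : y ∉ cutVertices U) (hA : x ∉ cutEdges U) (b : Bool) :
    deletedClass (gadgetGraph N k) U (Sum.inr (Sum.inl ⟨(x, y), h⟩)) =
      deletedClass (gadgetGraph N k) U (Sum.inl (x, b)) :=
  deletedClass_eq_of_adj _ _ (fun hm => hD ((incidence_mem_iff hU h).1 hm))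
    (fun hm => hA ((end_mem_iff hU x b).1 hm)) (by simp)

theorem class_end_eq_end (hU : IsSurplusBarrier (gadgetGraph N k) U) {x : X} (hA : x ∉ cutEdges U)
    (b b' : Bool) : deletedClass (gadgetGraph N k) U (Sum.inl (x, b)) =
      deletedClass (gadgetGraph N k) U (Sum.inl (x, b')) := by
  by_cases hb : b = b'
  · rw [hb]
  · exact deletedClass_eq_of_adj _ _ (fun hm => hA ((end_mem_iff hU x b).1 hm))
      (fun hm => hA ((end_mem_iff hU x b').1 hm)) (by simpa using hb)

/-- The class of a surviving hyperedge with all vertices cut or tight. -/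
theorem odd_card_inter_of_mem_oddClasses (hU : IsSurplusBarrier (gadgetGraph N k) U) {x : X}
    (hA : x ∉ cutEdges U) (hN : N x ⊆ cutVertices U ∪ tightVertices U)
    (hodd : deletedClass (gadgetGraph N k) U (Sum.inl (x, false)) ∈
      oddClasses (gadgetGraph N k) U) : Odd (N x ∩ tightVertices U).card := by
  let E : Finset {p : X × Y // p.2 ∈ N p.1} :=
    Finset.univ.filter fun e => e.1.1 = x ∧ e.1.2 ∈ tightVertices U
  have hE : E.card = (N x ∩ tightVertices U).card := by
    refine Finset.card_bij (fun e _ => e.1.2) ?_ ?_ ?_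
    · rintro ⟨⟨x', y⟩, h⟩ he
      obtain ⟨rfl, hT⟩ := (Finset.mem_filter.1 he).2
      exact Finset.mem_inter.2 ⟨h, hT⟩
    · rintro ⟨⟨x₁, y₁⟩, h₁⟩ he₁ ⟨⟨x₂, y₂⟩, h₂⟩ he₂ h
      obtain ⟨rfl, -⟩ := (Finset.mem_filter.1 he₁).2
      obtain ⟨rfl, -⟩ := (Finset.mem_filter.1 he₂).2
      simp only at h
      subst h
      rfl
    · intro y hy
      obtain ⟨h, hT⟩ := Finset.mem_inter.1 hy
      exact ⟨⟨(x, y), h⟩, by simp [E, hT], rfl⟩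
  have hclass : deletedClass (gadgetGraph N k) U (Sum.inl (x, false)) =
      (({x} : Finset X) ×ˢ (Finset.univ : Finset Bool)).disjSum (E.disjSum ∅) := by
    apply Finset.Subset.antisymm
    · refine deletedClass_subset_of_closed _ _ (by simp) ?_
      have hend : ∀ b, (Sum.inl (x, b) : GadgetVertex N k) ∈
          (({x} : Finset X) ×ˢ (Finset.univ : Finset Bool)).disjSum (E.disjSum ∅) := by simp
      rintro (⟨x', b⟩ | ⟨⟨x', y⟩, h⟩ | c) ha w hw hwU
      · simp only [Finset.inl_mem_disjSum, Finset.mem_product, Finset.mem_singleton,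
          Finset.mem_univ, and_true] at ha
        subst ha
        rcases w with ⟨x₁, b₁⟩ | ⟨⟨x₁, y₁⟩, h₁⟩ | c
        · simp only [gadgetGraph_adj_end_end] at hw
          obtain ⟨rfl, -⟩ := hw
          exact hend b₁
        · simp only [gadgetGraph_adj_end_incidence] at hw
          subst hw
          have hD : y₁ ∉ cutVertices U := fun h => hwU ((incidence_mem_iff hU h₁).2 h)
          have hT := (Finset.mem_union.1 (hN h₁)).resolve_left hD
          simp [E, hT]
        · simp at hw
      · simp only [Finset.inr_mem_disjSum, Finset.inl_mem_disjSum] at ha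
        obtain ⟨rfl, hT⟩ := (Finset.mem_filter.1 ha).2
        rcases w with ⟨x₁, b₁⟩ | e | ⟨y₁, j⟩
        · simp only [gadgetGraph_adj_incidence_end] at hw
          subst hw
          exact hend b₁
        · simp at hw
        · simp only [gadgetGraph_adj_incidence_core] at hw
          subst hw
          exact (hwU (core_mem hT j)).elim
      · simp at ha
    · rintro (⟨x', b⟩ | ⟨⟨x', y⟩, h⟩ | c) ha
      · simp only [Finset.inl_mem_disjSum, Finset.mem_product, Finset.mem_singleton,
          Finset.mem_univ, and_true] at ha
        subst ha
        rw [class_end_eq_end hU hA false b]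
        exact mem_deletedClass_self _ _ _
      · simp only [Finset.inr_mem_disjSum, Finset.inl_mem_disjSum] at ha
        obtain ⟨rfl, hT⟩ := (Finset.mem_filter.1 ha).2
        rw [← class_incidence_eq_end hU h
          (Finset.disjoint_right.1 disjoint_cutVertices_tightVertices hT) hA false]
        exact mem_deletedClass_self _ _ _
      · simp at ha
  have := (Finset.mem_filter.1 hodd).2
  rw [hclass, Finset.card_disjSum, Finset.card_disjSum, hE, Finset.card_product] at this
  simp only [Finset.card_singleton, Finset.card_univ, Fintype.card_bool, Finset.card_empty] at this
  rw [Nat.odd_iff] at this ⊢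
  omega

end GadgetBarrier

section Slot

open scoped Classical

/-- The choice of a slot for a surviving hyperedge with tight vertices `t`. -/
theorem exists_slot {Y : Type*} (t : Finset Y) (bad : Y → Prop) (triv o : Prop)
    (hodd : triv → o → Odd t.card) (hbad : ∀ y, ∀ y', bad y → bad y' → y = y')
    (ho : ∀ y, bad y → o) :
    ∃ P ⊆ t, (P.card = 2 ∨ (P.card ≤ 1 ∧ t = P) ∨ (t.card ≤ 1 ∧ P = ∅ ∧ triv)) ∧
      (triv → ∀ y ∈ P, ¬ bad y) ∧ P.card + (if triv ∧ o then 1 else 0) ≤ t.card := by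
  rcases le_or_gt 2 t.card with h2 | h2
  · by_cases htriv : triv
    · have hle : (t.filter bad).card ≤ 1 := Finset.card_le_one.2 fun a ha b hb =>
        hbad a b (Finset.mem_filter.1 ha).2 (Finset.mem_filter.1 hb).2
      have hsplit := Finset.card_filter_add_card_filter_not (s := t) bad
      have hcard : 2 ≤ (t.filter fun y => ¬ bad y).card ∧ (o → 3 ≤ t.card) := by
        by_cases h : o
        · obtain ⟨m, hm⟩ := hodd htriv h
          exact ⟨by omega, fun _ => by omega⟩
        · have : (t.filter bad).card = 0 := by
            rw [Finset.card_eq_zero, Finset.filter_eq_empty_iff]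
            exact fun y _ hy => h (ho y hy)
          exact ⟨by omega, fun h' => (h h').elim⟩
      obtain ⟨P, hP, hPc⟩ := Finset.exists_subset_card_eq hcard.1
      refine ⟨P, hP.trans (Finset.filter_subset _ _), Or.inl hPc,
        fun _ y hy => (Finset.mem_filter.1 (hP hy)).2, ?_⟩
      by_cases h : o
      · have := hcard.2 h
        simp only [htriv, h, and_self, if_true]
        omega
      · simp only [h, and_false, if_false]
        omega
    · obtain ⟨P, hP, hPc⟩ := Finset.exists_subset_card_eq h2
      refine ⟨P, hP, Or.inl hPc, fun h => (htriv h).elim, ?_⟩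
      simp only [htriv, false_and, if_false]
      omega
  · by_cases htriv : triv
    · refine ⟨∅, Finset.empty_subset _, Or.inr (Or.inr ⟨by omega, rfl, htriv⟩), by simp, ?_⟩
      by_cases h : o
      · have := (hodd htriv h).pos
        simp only [htriv, h, and_self, if_true, Finset.card_empty]
        omega
      · simp [h]
    · exact ⟨t, subset_rfl, Or.inr (Or.inl ⟨by omega, rfl⟩), fun h => (htriv h).elim,
        by simp [htriv]⟩

end Slot

section GadgetSlots

open scoped Classical

variable {X Y : Type*} [Fintype X] [Fintype Y] {N : X → Finset Y} {k : ℕ}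

/-- The odd classes of the vertices that are neither cut nor tight. -/
def vertexClasses (U : Finset (GadgetVertex N k)) : Finset (Finset (GadgetVertex N k)) :=
  (oddClasses (gadgetGraph N k) U).filter fun s =>
    ∃ z, z ∉ cutVertices U ∧ z ∉ tightVertices U ∧ vertexClass U z = s

/-- The surviving hyperedges with all vertices cut or tight whose ends lie in an odd class. -/
def closedEdges (U : Finset (GadgetVertex N k)) : Finset X :=
  (cutEdges U)ᶜ.filter fun x => N x ⊆ cutVertices U ∪ tightVertices U ∧
    deletedClass (gadgetGraph N k) U (Sum.inl (x, false)) ∈ oddClasses (gadgetGraph N k) U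

variable {U : Finset (GadgetVertex N k)}

theorem class_end_mem_vertexClasses (hU : IsSurplusBarrier (gadgetGraph N k) U) {x : X}
    (hA : x ∉ cutEdges U) (hN : ¬ N x ⊆ cutVertices U ∪ tightVertices U)
    (hodd : deletedClass (gadgetGraph N k) U (Sum.inl (x, false)) ∈
      oddClasses (gadgetGraph N k) U) :
    deletedClass (gadgetGraph N k) U (Sum.inl (x, false)) ∈ vertexClasses U := by
  obtain ⟨z, hz, hzDT⟩ := Finset.not_subset.1 hN
  rw [Finset.mem_union, not_or] at hzDT
  refine Finset.mem_filter.2 ⟨hodd, z, hzDT.1, hzDT.2, ?_⟩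
  rw [← class_incidence_eq_end hU hz hzDT.1 hA,
    class_incidence_eq_vertexClass hU hz hzDT.1 hzDT.2]

theorem card_barrier_le (hU : IsSurplusBarrier (gadgetGraph N k) U) :
    2 * (cutEdges U).card + ∑ y ∈ cutVertices U, hyperDegree N y +
      ∑ y ∈ tightVertices U, (hyperDegree N y - k) ≤ U.card := by
  have hsub : ((cutEdges U) ×ˢ (Finset.univ : Finset Bool)).disjSum
      ((Finset.univ.filter fun e : {p : X × Y // p.2 ∈ N p.1} => e.1.2 ∈ cutVertices U).disjSum
        ((tightVertices U).sigma fun y => (Finset.univ : Finset (Fin (hyperDegree N y - k)))))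
      ⊆ U := by
    rintro (⟨x, b⟩ | ⟨⟨x, y⟩, h⟩ | ⟨y, j⟩) hv
    · exact (end_mem_iff hU x b).2 (by simpa using hv)
    · exact (incidence_mem_iff hU h).2 (by simpa using hv)
    · exact core_mem (by simpa using hv) j
  have h := Finset.card_le_card hsub
  rw [Finset.card_disjSum, Finset.card_disjSum, card_incidence_filter, Finset.card_product,
    Finset.card_sigma] at h
  simp only [Finset.card_univ, Fintype.card_bool, Fintype.card_fin] at h
  omega

theorem card_oddClasses_le (hk : 1 ≤ k) (hdeg : ∀ y, k ≤ hyperDegree N y)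
    (hU : IsSurplusBarrier (gadgetGraph N k) U) :
    (oddClasses (gadgetGraph N k) U).card ≤ ∑ y ∈ cutVertices U, (hyperDegree N y - k) +
      ∑ x ∈ cutEdges U, (N x ∩ tightVertices U).card + (vertexClasses U).card +
      (closedEdges U).card := by
  let cores : Finset (Σ y : Y, Fin (hyperDegree N y - k)) :=
    (cutVertices U).sigma fun y => (Finset.univ : Finset (Fin (hyperDegree N y - k)))
  let incs : Finset {p : X × Y // p.2 ∈ N p.1} :=
    Finset.univ.filter fun e => e.1.1 ∈ cutEdges U ∧ e.1.2 ∈ tightVertices U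
  have hcores : cores.card = ∑ y ∈ cutVertices U, (hyperDegree N y - k) := by
    rw [Finset.card_sigma]
    simp
  have hincs : incs.card ≤ ∑ x ∈ cutEdges U, (N x ∩ tightVertices U).card := by
    rw [← Finset.card_sigma]
    refine Finset.card_le_card_of_injOn (fun e => ⟨e.1.1, e.1.2⟩) ?_ ?_
    · rintro ⟨⟨x, y⟩, h⟩ he
      have := (Finset.mem_filter.1 (Finset.mem_coe.1 he)).2
      exact Finset.mem_coe.2 (Finset.mem_sigma.2 ⟨this.1, Finset.mem_inter.2 ⟨h, this.2⟩⟩)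
    · rintro ⟨⟨x, y⟩, h⟩ _ ⟨⟨x', y'⟩, h'⟩ _ heq
      simp only [Sigma.mk.injEq, heq_eq_eq] at heq
      obtain ⟨rfl, rfl⟩ := heq
      rfl
  let c := deletedClass (gadgetGraph N k) U
  have hsub : oddClasses (gadgetGraph N k) U ⊆ cores.image (fun v => c (Sum.inr (Sum.inr v))) ∪
      incs.image (fun e => c (Sum.inr (Sum.inl e))) ∪ vertexClasses U ∪
      (closedEdges U).image (fun x => c (Sum.inl (x, false))) := by
    intro s hs
    obtain ⟨v, hv, rfl⟩ := exists_of_mem_oddClasses hs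
    have hend : ∀ x ∉ cutEdges U, c (Sum.inl (x, false)) ∈ oddClasses (gadgetGraph N k) U →
        c (Sum.inl (x, false)) ∈ cores.image (fun v => c (Sum.inr (Sum.inr v))) ∪
          incs.image (fun e => c (Sum.inr (Sum.inl e))) ∪ vertexClasses U ∪
          (closedEdges U).image (fun x => c (Sum.inl (x, false))) := by
      intro x hA hodd
      by_cases hN : N x ⊆ cutVertices U ∪ tightVertices U
      · refine Finset.mem_union_right _ (Finset.mem_image.2 ⟨x, ?_, rfl⟩)
        exact Finset.mem_filter.2 ⟨Finset.mem_compl.2 hA, hN, hodd⟩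
      · exact Finset.mem_union_left _ (Finset.mem_union_right _
          (class_end_mem_vertexClasses hU hA hN hodd))
    have hinc : ∀ x y (h : y ∈ N x), y ∉ cutVertices U → y ∉ tightVertices U →
        c (Sum.inr (Sum.inl ⟨(x, y), h⟩)) ∈ oddClasses (gadgetGraph N k) U →
        c (Sum.inr (Sum.inl ⟨(x, y), h⟩)) ∈ vertexClasses U := fun x y h hD hT hodd =>
      Finset.mem_filter.2 ⟨hodd, y, hD, hT, (class_incidence_eq_vertexClass hU h hD hT).symm⟩
    rcases v with ⟨x, b⟩ | ⟨⟨x, y⟩, h⟩ | ⟨y, j⟩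
    · have hA : x ∉ cutEdges U := fun h => hv ((end_mem_iff hU x b).2 h)
      rw [class_end_eq_end hU hA b false] at hs ⊢
      exact hend x hA hs
    · have hD : y ∉ cutVertices U := fun h' => hv ((incidence_mem_iff hU h).2 h')
      by_cases hA : x ∈ cutEdges U
      · by_cases hT : y ∈ tightVertices U
        · refine Finset.mem_union_left _ (Finset.mem_union_left _ (Finset.mem_union_right _ ?_))
          exact Finset.mem_image.2 ⟨⟨(x, y), h⟩, by simp [incs, hA, hT], rfl⟩
        · exact Finset.mem_union_left _ (Finset.mem_union_right _ (hinc x y h hD hT hs))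
      · rw [class_incidence_eq_end hU h hD hA false] at hs ⊢
        exact hend x hA hs
    · by_cases hD : y ∈ cutVertices U
      · refine Finset.mem_union_left _ (Finset.mem_union_left _ (Finset.mem_union_left _ ?_))
        exact Finset.mem_image.2 ⟨⟨y, j⟩, by simp [cores, hD], rfl⟩
      · have hT : y ∉ tightVertices U := fun h => hv (core_mem h j)
        obtain ⟨x, hx⟩ : ∃ x, y ∈ N x := by
          obtain ⟨x, hx⟩ := Finset.card_pos.1 (hk.trans (hdeg y))
          exact ⟨x, (Finset.mem_filter.1 hx).2⟩
        rw [← class_incidence_eq_core hU hx hD hT j] at hs ⊢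
        exact Finset.mem_union_left _ (Finset.mem_union_right _ (hinc x y hx hD hT hs))
  have h1 := Finset.card_le_card hsub
  have h2 := Finset.card_union_le (cores.image (fun v => c (Sum.inr (Sum.inr v))) ∪
      incs.image (fun e => c (Sum.inr (Sum.inl e))) ∪ vertexClasses U)
      ((closedEdges U).image (fun x => c (Sum.inl (x, false))))
  have h3 := Finset.card_union_le (cores.image (fun v => c (Sum.inr (Sum.inr v))) ∪
      incs.image (fun e => c (Sum.inr (Sum.inl e)))) (vertexClasses U)
  have h4 := Finset.card_union_le (cores.image (fun v => c (Sum.inr (Sum.inr v))))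
      (incs.image (fun e => c (Sum.inr (Sum.inl e))))
  have h5 := Finset.card_image_le (s := cores) (f := fun v => c (Sum.inr (Sum.inr v)))
  have h6 := Finset.card_image_le (s := incs) (f := fun e => c (Sum.inr (Sum.inl e)))
  have h7 := Finset.card_image_le (s := closedEdges U) (f := fun x => c (Sum.inl (x, false)))
  omega

theorem deficiency_le (hk : 1 ≤ k) (hdeg : ∀ y, k ≤ hyperDegree N y)
    (hU : IsSurplusBarrier (gadgetGraph N k) U) :
    k * (cutVertices U).card + 2 * (cutEdges U).card +
        ∑ x ∈ (cutEdges U)ᶜ, (N x ∩ tightVertices U).card + 2 ≤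
      k * (tightVertices U).card + (vertexClasses U).card + (closedEdges U).card := by
  have h1 := card_barrier_le hU
  have h2 := card_oddClasses_le hk hdeg hU
  have h3 := hU.1
  have hsum : ∀ W : Finset Y, ∑ y ∈ W, (hyperDegree N y - k) + k * W.card =
      ∑ y ∈ W, hyperDegree N y := by
    intro W
    rw [mul_comm, ← smul_eq_mul, ← Finset.sum_const, ← Finset.sum_add_distrib]
    exact Finset.sum_congr rfl fun y _ => Nat.sub_add_cancel (hdeg y)
  have h4 := hsum (cutVertices U)
  have h5 := hsum (tightVertices U)
  have h6 := sum_hyperDegree N (tightVertices U)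
  have h7 := Finset.sum_add_sum_compl (cutEdges U) fun x => (N x ∩ tightVertices U).card
  omega

end GadgetSlots

section GadgetSlotBarrier

open scoped Classical

variable {X Y : Type*} [Fintype X] [Fintype Y] {N : X → Finset Y} {k : ℕ}
  {U : Finset (GadgetVertex N k)}

theorem exists_slotBarrier [Nonempty Y] (hk : 1 ≤ k) (hdeg : ∀ y, k ≤ hyperDegree N y)
    (hU : IsSurplusBarrier (gadgetGraph N k) U) :
    Nonempty (SlotBarrier N k (Finset (GadgetVertex N k))) := by
  obtain ⟨w, hw, hinj⟩ := hU.exists_transversal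
  let c := deletedClass (gadgetGraph N k) U
  have hσ : ∀ p : X × Bool, ∃ y, p.1 ∈ cutEdges U → ∃ h : y ∈ N p.1, y ∉ cutVertices U ∧
      w (Sum.inl p) = Sum.inr (Sum.inl ⟨(p.1, y), h⟩) := by
    rintro ⟨x, b⟩
    by_cases hA : x ∈ cutEdges U
    · obtain ⟨hadj, hwU, -⟩ := hw _ ((end_mem_iff hU x b).2 hA)
      rcases hwe : w (Sum.inl (x, b)) with ⟨x', b'⟩ | ⟨⟨x', y⟩, h⟩ | v
      · rw [hwe] at hadj hwU
        simp only [gadgetGraph_adj_end_end] at hadj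
        obtain ⟨rfl, -⟩ := hadj
        exact (hwU ((end_mem_iff hU x b').2 hA)).elim
      · rw [hwe] at hadj hwU
        simp only [gadgetGraph_adj_end_incidence] at hadj
        subst hadj
        exact ⟨y, fun _ => ⟨h, fun hD => hwU ((incidence_mem_iff hU h).2 hD), rfl⟩⟩
      · rw [hwe] at hadj
        simp at hadj
    · exact ⟨Classical.arbitrary Y, fun h => (hA h).elim⟩
  choose σ hσ using hσ
  have hψ : ∀ y (j : Fin (hyperDegree N y - k)), ∃ x, y ∈ tightVertices U → ∃ h : y ∈ N x,
      w (Sum.inr (Sum.inr ⟨y, j⟩)) = Sum.inr (Sum.inl ⟨(x, y), h⟩) := by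
    intro y j
    by_cases hT : y ∈ tightVertices U
    · obtain ⟨hadj, -⟩ := hw _ (core_mem hT j)
      rcases hwe : w (Sum.inr (Sum.inr ⟨y, j⟩)) with p | ⟨⟨x, y'⟩, h⟩ | v
      · rw [hwe] at hadj
        simp at hadj
      · rw [hwe] at hadj
        simp only [gadgetGraph_adj_core_incidence] at hadj
        subst hadj
        exact ⟨x, fun _ => ⟨h, rfl⟩⟩
      · rw [hwe] at hadj
        simp at hadj
    · obtain ⟨x, -⟩ := Finset.card_pos.1 (hk.trans (hdeg y))
      exact ⟨x, fun h => (hT h).elim⟩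
  choose ψ hψ using hψ
  have hne : ∀ x ∈ cutEdges U, σ (x, false) ≠ σ (x, true) := by
    intro x hA heq
    obtain ⟨h₁, -, e₁⟩ := hσ (x, false) hA
    obtain ⟨h₂, -, e₂⟩ := hσ (x, true) hA
    have : w (Sum.inl (x, false)) = w (Sum.inl (x, true)) := by
      rw [e₁, e₂]
      simp [heq]
    have := hinj _ ((end_mem_iff hU x false).2 hA) _ ((end_mem_iff hU x true).2 hA)
      (congrArg _ this)
    simp at this
  let bad : X → Y → Prop := fun x y =>
    y ∈ tightVertices U ∧ ∃ j, c (w (Sum.inr (Sum.inr ⟨y, j⟩))) = c (Sum.inl (x, false))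
  have hslot : ∀ x, ∃ P ⊆ N x ∩ tightVertices U, x ∉ cutEdges U →
      (P.card = 2 ∨ (P.card ≤ 1 ∧ N x ∩ tightVertices U = P) ∨
        ((N x ∩ tightVertices U).card ≤ 1 ∧ P = ∅ ∧ N x ⊆ cutVertices U ∪ tightVertices U)) ∧
      (N x ⊆ cutVertices U ∪ tightVertices U → ∀ y ∈ P, ¬ bad x y) ∧
      P.card + (if N x ⊆ cutVertices U ∪ tightVertices U ∧
        c (Sum.inl (x, false)) ∈ oddClasses (gadgetGraph N k) U then 1 else 0) ≤
          (N x ∩ tightVertices U).card := by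
    intro x
    by_cases hA : x ∈ cutEdges U
    · exact ⟨∅, Finset.empty_subset _, fun h => (h hA).elim⟩
    · obtain ⟨P, hP, h⟩ := exists_slot (N x ∩ tightVertices U) (bad x)
        (N x ⊆ cutVertices U ∪ tightVertices U)
        (c (Sum.inl (x, false)) ∈ oddClasses (gadgetGraph N k) U)
        (odd_card_inter_of_mem_oddClasses hU hA) (by
          rintro y y' ⟨hy, j, hj⟩ ⟨hy', j', hj'⟩
          have := hinj _ (core_mem hy j) _ (core_mem hy' j') (hj.trans hj'.symm)
          simp only [Sum.inr.injEq, Sigma.mk.injEq] at this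
          exact this.1) (by
          rintro y ⟨hy, j, hj⟩
          rw [← hj]
          exact (hw _ (core_mem hy j)).2.2)
      exact ⟨P, hP, fun _ => by convert h⟩
  choose P hPsub hP using hslot
  let sl : X → Finset Y := fun x =>
    if x ∈ cutEdges U then ({σ (x, false), σ (x, true)} : Finset Y).filter (· ∈ tightVertices U)
    else P x
  have hslA : ∀ x ∈ cutEdges U,
      sl x = ({σ (x, false), σ (x, true)} : Finset Y).filter (· ∈ tightVertices U) :=
    fun x hA => if_pos hA
  have hslN : ∀ x ∉ cutEdges U, sl x = P x := fun x hA => if_neg hA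
  have hslT : ∀ x, sl x ⊆ tightVertices U := by
    intro x
    by_cases hA : x ∈ cutEdges U
    · rw [hslA x hA]
      exact fun y hy => (Finset.mem_filter.1 hy).2
    · rw [hslN x hA]
      exact (hPsub x).trans Finset.inter_subset_right
  have hslsub : ∀ x, sl x ⊆ N x := by
    intro x
    by_cases hA : x ∈ cutEdges U
    · rw [hslA x hA]
      intro y hy
      have hy := (Finset.mem_filter.1 hy).1
      rw [Finset.mem_insert, Finset.mem_singleton] at hy
      rcases hy with rfl | rfl
      · exact (hσ (x, false) hA).1
      · exact (hσ (x, true) hA).1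
    · rw [hslN x hA]
      exact (hPsub x).trans Finset.inter_subset_left
  have hsl2 : ∀ x ∈ cutEdges U, (sl x).card ≤ 2 := by
    intro x hA
    rw [hslA x hA]
    exact (Finset.card_filter_le _ _).trans Finset.card_le_two
  refine ⟨{
    D := cutVertices U
    T := tightVertices U
    lab := vertexClass U
    Q := vertexClasses U
    A := cutEdges U
    sl := sl
    disjoint := disjoint_cutVertices_tightVertices
    exists_lab := fun q hq => (Finset.mem_filter.1 hq).2
    sl_subset := hslsub
    sl_subset_T := hslT
    sl_of_mem := fun x hA => ⟨_, (hσ (x, false) hA).1, _, (hσ (x, true) hA).1, hne x hA,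
      (hσ (x, false) hA).2.1, (hσ (x, true) hA).2.1, hslA x hA⟩
    lab_eq := fun x hA a ha b hb haD haT hbD hbT => by
      rw [← class_incidence_eq_vertexClass hU ha haD haT,
        ← class_incidence_eq_vertexClass hU hb hbD hbT,
        class_incidence_eq_end hU ha haD hA false, class_incidence_eq_end hU hb hbD hA false]
    sl_of_notMem := fun x hA => by
      rw [hslN x hA]
      exact (hP x hA).1
    count₁ := ?_
    count₂ := ?_ }⟩
  · have h0 := deficiency_le hk hdeg hU
    have h1 := sum_hyperDegree sl (tightVertices U)
    have h2 := Finset.sum_add_sum_compl (cutEdges U) fun x => (sl x ∩ tightVertices U).card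
    have h3 : ∑ x ∈ cutEdges U, (sl x ∩ tightVertices U).card +
        ∑ x ∈ cutEdges U, (2 - (sl x).card) = 2 * (cutEdges U).card := by
      rw [← Finset.sum_add_distrib, Finset.sum_congr rfl fun x hA => ?_, Finset.sum_const,
        smul_eq_mul, mul_comm]
      rw [Finset.inter_eq_left.2 (hslT x)]
      exact Nat.add_sub_cancel' (hsl2 x hA)
    have h4 : ∑ x ∈ (cutEdges U)ᶜ, (sl x ∩ tightVertices U).card + (closedEdges U).card ≤
        ∑ x ∈ (cutEdges U)ᶜ, (N x ∩ tightVertices U).card := by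
      rw [closedEdges, Finset.card_filter, ← Finset.sum_add_distrib]
      refine Finset.sum_le_sum fun x hx => ?_
      have hA := Finset.mem_compl.1 hx
      rw [Finset.inter_eq_left.2 (hslT x), hslN x hA]
      refine le_of_eq_of_le ?_ (hP x hA).2.2
      congr
    omega
  · let ends : Finset (X × Bool) :=
      (cutEdges U ×ˢ Finset.univ).filter fun p => σ p ∉ tightVertices U
    let J : ∀ y, Finset (Fin (hyperDegree N y - k)) := fun y =>
      Finset.univ.filter fun j => c (w (Sum.inr (Sum.inr ⟨y, j⟩))) ∈ vertexClasses U
    have hle : (ends.disjSum ((∅ : Finset {p : X × Y // p.2 ∈ N p.1}).disjSum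
        ((tightVertices U).sigma J))).card ≤ (vertexClasses U).card := by
      have hmem : ∀ u ∈ ends.disjSum ((∅ : Finset {p : X × Y // p.2 ∈ N p.1}).disjSum
          ((tightVertices U).sigma J)), u ∈ U ∧ c (w u) ∈ vertexClasses U := by
        rintro (⟨x, b⟩ | e | ⟨y, j⟩) hu
        · rw [Finset.inl_mem_disjSum] at hu
          obtain ⟨hA, hT⟩ := Finset.mem_filter.1 hu
          have hA := (Finset.mem_product.1 hA).1
          have huU := (end_mem_iff hU x b).2 hA
          refine ⟨huU, Finset.mem_filter.2 ⟨(hw _ huU).2.2, σ (x, b), ?_⟩⟩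
          obtain ⟨h, hD, hwe⟩ := hσ (x, b) hA
          refine ⟨hD, hT, ?_⟩
          rw [hwe]
          exact (class_incidence_eq_vertexClass hU h hD hT).symm
        · simp at hu
        · rw [Finset.inr_mem_disjSum, Finset.inr_mem_disjSum] at hu
          obtain ⟨hT, hj⟩ := Finset.mem_sigma.1 hu
          exact ⟨core_mem hT j, (Finset.mem_filter.1 hj).2⟩
      exact Finset.card_le_card_of_injOn (fun u => c (w u)) (fun u hu => (hmem u hu).2)
        fun u hu u' hu' h => hinj u (hmem u hu).1 u' (hmem u' hu').1 h
    rw [Finset.card_disjSum, Finset.card_disjSum, Finset.card_empty, zero_add,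
      Finset.card_sigma] at hle
    have hends : ∑ x ∈ cutEdges U, (2 - (sl x).card) ≤ ends.card := by
      rw [Finset.card_filter, Finset.sum_product]
      refine Finset.sum_le_sum fun x hA => ?_
      rw [hslA x hA, Fintype.sum_bool]
      have := hne x hA
      by_cases h₁ : σ (x, false) ∈ tightVertices U <;>
        by_cases h₂ : σ (x, true) ∈ tightVertices U <;>
        simp [Finset.filter_insert, Finset.filter_singleton, h₁, h₂, this]
    have hcores : ∑ y ∈ tightVertices U, (hyperDegree sl y - k) ≤
        ∑ y ∈ tightVertices U, (J y).card := by
      refine Finset.sum_le_sum fun y hT => ?_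
      have hdisj : Disjoint (Finset.univ.filter fun x => y ∈ sl x) ((J y)ᶜ.image (ψ y)) := by
        rw [Finset.disjoint_right]
        intro x hx hyx
        obtain ⟨j, hj, rfl⟩ := Finset.mem_image.1 hx
        have hyx := (Finset.mem_filter.1 hyx).2
        have hj : c (w (Sum.inr (Sum.inr ⟨y, j⟩))) ∉ vertexClasses U := by simpa [J] using hj
        obtain ⟨h, hwe⟩ := hψ y j hT
        have hD : y ∉ cutVertices U :=
          Finset.disjoint_right.1 disjoint_cutVertices_tightVertices hT
        by_cases hA : ψ y j ∈ cutEdges U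
        · have hσy : ∃ b, y = σ (ψ y j, b) := by
            rw [hslA _ hA] at hyx
            have hyx := (Finset.mem_filter.1 hyx).1
            rw [Finset.mem_insert, Finset.mem_singleton] at hyx
            exact hyx.elim (fun h => ⟨_, h⟩) fun h => ⟨_, h⟩
          obtain ⟨b, hb⟩ := hσy
          obtain ⟨h', -, hwe'⟩ := hσ (ψ y j, b) hA
          have heq : w (Sum.inr (Sum.inr ⟨y, j⟩)) = w (Sum.inl (ψ y j, b)) := by
            rw [hwe, hwe']
            simp [← hb]
          have := hinj _ (core_mem hT j) _ ((end_mem_iff hU _ b).2 hA) (congrArg _ heq)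
          simp at this
        · have hcl : c (w (Sum.inr (Sum.inr ⟨y, j⟩))) = c (Sum.inl (ψ y j, false)) := by
            rw [hwe]
            exact class_incidence_eq_end hU h hD hA false
          by_cases htriv : N (ψ y j) ⊆ cutVertices U ∪ tightVertices U
          · rw [hslN _ hA] at hyx
            exact (hP _ hA).2.1 htriv y hyx ⟨hT, j, hcl⟩
          · rw [hcl] at hj
            refine hj (class_end_mem_vertexClasses hU hA htriv ?_)
            have := (hw _ (core_mem hT j)).2.2
            change c _ ∈ _ at this
            rwa [hcl] at this
      have hcard : ((J y)ᶜ.image (ψ y)).card = (J y)ᶜ.card := by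
        refine Finset.card_image_of_injective _ fun j j' hjj => ?_
        obtain ⟨h, hwe⟩ := hψ y j hT
        obtain ⟨h', hwe'⟩ := hψ y j' hT
        have heq : w (Sum.inr (Sum.inr ⟨y, j⟩)) = w (Sum.inr (Sum.inr ⟨y, j'⟩)) := by
          rw [hwe, hwe']
          simp [hjj]
        have := hinj _ (core_mem hT j) _ (core_mem hT j') (congrArg _ heq)
        simpa using this
      have hsub : (Finset.univ.filter fun x => y ∈ sl x) ∪ (J y)ᶜ.image (ψ y) ⊆
          Finset.univ.filter fun x => y ∈ N x := by
        intro x hx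
        refine Finset.mem_filter.2 ⟨Finset.mem_univ _, ?_⟩
        rcases Finset.mem_union.1 hx with hx | hx
        · exact hslsub x (Finset.mem_filter.1 hx).2
        · obtain ⟨j, -, rfl⟩ := Finset.mem_image.1 hx
          exact (hψ y j hT).1
      have h1 := Finset.card_le_card hsub
      rw [Finset.card_union_of_disjoint hdisj, hcard] at h1
      change hyperDegree sl y + _ ≤ hyperDegree N y at h1
      have h2 := Finset.card_add_card_compl (J y)
      rw [Fintype.card_fin] at h2
      have h3 := hdeg y
      omega
    omega

end GadgetSlotBarrier

section Bipartite

open scoped Classical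

variable {X Y : Type*} [Fintype Y]

/-- The neighbours in `Y` of a vertex of `X`. -/
def rightNeighbors (G : SimpleGraph (X ⊕ Y)) (x : X) : Finset Y :=
  Finset.univ.filter fun y => G.Adj (Sum.inl x) (Sum.inr y)

theorem mem_rightNeighbors {G : SimpleGraph (X ⊕ Y)} {x : X} {y : Y} :
    y ∈ rightNeighbors G x ↔ G.Adj (Sum.inl x) (Sum.inr y) := by
  simp [rightNeighbors]

variable [Fintype X]

/-- A labelling of `Y` that is constant on the neighbourhoods avoiding `S` takes on `Sᶜ` at most
as many values as the strong deletion has components. -/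
theorem card_image_le_cStrong {ι : Type*} {G : SimpleGraph (X ⊕ Y)}
    (hX : ∀ x x' : X, ¬ G.Adj (Sum.inl x) (Sum.inl x'))
    (hY : ∀ y y' : Y, ¬ G.Adj (Sum.inr y) (Sum.inr y'))
    (hiso : ∀ x : X, ∃ w, G.Adj (Sum.inl x) w) (S : Finset Y) (f : Y → ι)
    (hf : ∀ x, Disjoint (rightNeighbors G x) S →
      ∀ a ∈ rightNeighbors G x, ∀ b ∈ rightNeighbors G x, f a = f b) :
    (Sᶜ.image f).card ≤ cStrong G (Sum.inr '' (S : Set Y)) := by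
  have hnb : ∀ x : X, ∃ y, y ∈ rightNeighbors G x := by
    intro x
    obtain ⟨x' | y, h⟩ := hiso x
    · exact (hX x x' h).elim
    · exact ⟨y, mem_rightNeighbors.2 h⟩
  choose g hg using hnb
  let W : Set (X ⊕ Y) :=
    (Sum.inr '' (S : Set Y) ∪ ⋃ v ∈ Sum.inr '' (S : Set Y), G.neighborSet v)ᶜ
  have hWX : ∀ x, Sum.inl x ∈ W → Disjoint (rightNeighbors G x) S := by
    intro x hx
    rw [Finset.disjoint_left]
    intro y hy hyS
    refine hx (Or.inr ?_)
    simp only [Set.mem_iUnion]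
    exact ⟨Sum.inr y, ⟨y, hyS, rfl⟩, (mem_rightNeighbors.1 hy).symm⟩
  have hWY : ∀ y ∉ S, Sum.inr y ∈ W := by
    rintro y hy (⟨y', hy', h⟩ | h)
    · exact hy (Sum.inr_injective h ▸ hy')
    · simp only [Set.mem_iUnion] at h
      obtain ⟨v, ⟨y', -, rfl⟩, h⟩ := h
      exact hY y' y h
  let lab : X ⊕ Y → ι := Sum.elim (fun x => f (g x)) f
  have hadj : ∀ v ∈ W, ∀ w ∈ W, G.Adj v w → lab v = lab w := by
    rintro (x | y) hv (x' | y') hw h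
    · exact (hX x x' h).elim
    · exact hf x (hWX x hv) _ (hg x) _ (mem_rightNeighbors.2 h)
    · exact hf x' (hWX x' hw) _ (mem_rightNeighbors.2 h.symm) _ (hg x')
    · exact (hY y y' h).elim
  have hreach : ∀ v w : W, (G.induce W).Reachable v w → lab v = lab w := by
    rintro v w ⟨p⟩
    induction p with
    | nil => rfl
    | cons h _ ih => exact (hadj _ (Subtype.property _) _ (Subtype.property _) h).trans ih
  let F : (G.induce W).ConnectedComponent → ι := fun C =>
    C.lift (fun v : W => lab v) fun v w p _ => hreach v w ⟨p⟩
  have hsub : Sᶜ.image f ⊆ Finset.univ.image F := by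
    intro i hi
    obtain ⟨y, hy, rfl⟩ := Finset.mem_image.1 hi
    exact Finset.mem_image.2 ⟨(G.induce W).connectedComponentMk
      ⟨Sum.inr y, hWY y (Finset.mem_compl.1 hy)⟩, Finset.mem_univ _, rfl⟩
  calc (Sᶜ.image f).card ≤ (Finset.univ.image F).card := Finset.card_le_card hsub
    _ ≤ Fintype.card (G.induce W).ConnectedComponent := Finset.card_image_le
    _ = cStrong G (Sum.inr '' (S : Set Y)) := Nat.card_eq_fintype_card.symm

theorem isStronglyTough_rightNeighbors {G : SimpleGraph (X ⊕ Y)} {k : ℕ}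
    (hX : ∀ x x' : X, ¬ G.Adj (Sum.inl x) (Sum.inl x'))
    (hY : ∀ y y' : Y, ¬ G.Adj (Sum.inr y) (Sum.inr y'))
    (hiso : ∀ x : X, ∃ w, G.Adj (Sum.inl x) w)
    (htough : ∀ S : Set (X ⊕ Y), S ⊆ Set.range Sum.inr →
      2 ≤ cStrong G S → k * cStrong G S ≤ S.ncard) :
    IsStronglyTough (rightNeighbors G) k := by
  intro S f hf h2
  have hle := card_image_le_cStrong hX hY hiso S f hf
  refine (Nat.mul_le_mul_left k hle).trans
    ((htough _ (Set.image_subset_range _ _) (h2.trans hle)).trans_eq ?_)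
  rw [Set.ncard_image_of_injective _ Sum.inr_injective, Set.ncard_coe_finset]

/-- The bipartite graph of a relation. -/
def relationGraph {X Y : Type*} (P : X → Y → Prop) : SimpleGraph (X ⊕ Y) where
  Adj
    | Sum.inl x, Sum.inr y => P x y
    | Sum.inr y, Sum.inl x => P x y
    | _, _ => False
  symm := ⟨by rintro (x | y) (x' | y') h <;> exact h⟩
  loopless := ⟨by rintro (x | y) h <;> exact h⟩

theorem neighborSet_relationGraph_inl {X Y : Type*} (P : X → Y → Prop) (x : X) :
    (relationGraph P).neighborSet (Sum.inl x) = Sum.inr '' {y | P x y} := by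
  ext (x' | y) <;> simp [relationGraph]

theorem neighborSet_relationGraph_inr {X Y : Type*} (P : X → Y → Prop) (y : Y) :
    (relationGraph P).neighborSet (Sum.inr y) = Sum.inl '' {x | P x y} := by
  ext (x | y') <;> simp [relationGraph]

end Bipartite

/-- a bipartite graph `G[X,Y]` without isolated vertices in `X`, with
`τ_Y(G) ≥ k`, `k·|Y|` even and `|Y| ≥ k + 1`, has a `(2,k)`-factor. -/
theorem tough_bipartite_has_two_k_factor {X Y : Type*} [Fintype X] [Fintype Y]
    (G : SimpleGraph (X ⊕ Y))
    (hX : ∀ x x' : X, ¬ G.Adj (Sum.inl x) (Sum.inl x'))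
    (hY : ∀ y y' : Y, ¬ G.Adj (Sum.inr y) (Sum.inr y'))
    (hiso : ∀ x : X, ∃ w, G.Adj (Sum.inl x) w)
    (k : ℕ) (hk : 1 ≤ k)
    (htough : ∀ S : Set (X ⊕ Y), S ⊆ Set.range Sum.inr →
      2 ≤ cStrong G S → k * cStrong G S ≤ S.ncard)
    (heven : Even (k * Fintype.card Y))
    (hcard : k + 1 ≤ Fintype.card Y) :
    ∃ F : SimpleGraph (X ⊕ Y), F ≤ G ∧
      (∀ x : X, (F.neighborSet (Sum.inl x)).ncard = 0 ∨ (F.neighborSet (Sum.inl x)).ncard = 2) ∧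
      (∀ y : Y, (F.neighborSet (Sum.inr y)).ncard = k) := by
  classical
  have : Nonempty Y := Fintype.card_pos_iff.1 (by omega)
  have hN : IsStronglyTough (rightNeighbors G) k :=
    isStronglyTough_rightNeighbors hX hY hiso htough
  have hdeg : ∀ y, k ≤ hyperDegree (rightNeighbors G) y := hN.le_degree hcard
  have hM : ∃ M : (gadgetGraph (rightNeighbors G) k).Subgraph, M.IsPerfectMatching := by
    by_contra hM
    obtain ⟨U, hU⟩ := exists_surplus_barrier _ (even_card_gadgetVertex hdeg heven) hM
    obtain ⟨B⟩ := exists_slotBarrier hk hdeg hU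
    exact (SlotBarrier.isEmpty_of_isStronglyTough hN hk hcard).false B
  obtain ⟨M, hM⟩ := hM
  obtain ⟨P, hPN, hPX, hPY⟩ := exists_factor_of_isPerfectMatching hdeg hM
  refine ⟨relationGraph P, ?_, fun x => ?_, fun y => ?_⟩
  · rintro (x | y) (x' | y') h
    · exact h.elim
    · exact mem_rightNeighbors.1 (hPN x y' h)
    · exact (mem_rightNeighbors.1 (hPN x' y h)).symm
    · exact h.elim
  · rw [neighborSet_relationGraph_inl, Set.ncard_image_of_injective _ Sum.inr_injective]
    exact hPX x
  · rw [neighborSet_relationGraph_inr, Set.ncard_image_of_injective _ Sum.inl_injective]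
    exact hPY y
end
end
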